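/- Let U be an irreducible six-dimensional complex representation of the quasi-simple group 3.A7. If U is faithful, then S²U∨ decomposes as a direct sum U ⊕ U₁₅ where U₁₅ is a faithful irreducible representation of dimension 15. If U is not faithful (so U factors through the simple quotient A7), then S²U∨ decomposes as a direct sum of the trivial representation, a copy of U, and an irreducible non-faithful representation of dimension 14. In either case, S²U∨ contains a unique six-dimensional irreducible subrepresentation, namely the span of the partial derivatives of the (unique up to scalar) invariant cubic form on U. -/

import Mathlib

/-- `G` is isomorphic to `3.A₇`: a quasi-simple (in particular perfect) group whose center is
cyclic of order `3` and whose quotient by the center is the alternating group `A₇`.  Such a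
group is unique up to isomorphism. -/
def IsTripleCoverA7 (G : Type*) [Group G] : Prop :=
  commutator G = ⊤ ∧ IsCyclic (Subgroup.center G) ∧ Nat.card (Subgroup.center G) = 3 ∧
    Nonempty (G ⧸ Subgroup.center G ≃* alternatingGroup (Fin 7))

section SymForms

variable (G : Type) [Group G] (U : Type) [AddCommGroup U] [Module ℂ U]

/-- The space `SᵏU∨` of homogeneous polynomial functions of degree `k` on `U`:
the span, inside the space of all functions `U → ℂ`, of products of `k` linear functionals. -/
noncomputable def symFormSpace (k : ℕ) : Submodule ℂ (U → ℂ) :=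
  Submodule.span ℂ {f | ∃ φ : Fin k → Module.Dual ℂ U, f = fun u => ∏ i, φ i u}

variable {G U}

/-- The (right) translation of a function on `U` by a group element, via `ρ`; a subspace of
functions is `G`-stable for the natural action `q ↦ q ∘ ρ(g⁻¹)` iff it is stable under all the
maps `formAct ρ g`. -/
def formAct (ρ : Representation ℂ G U) (g : G) (f : U → ℂ) : U → ℂ :=
  fun u => f (ρ g u)

/-- A subspace of functions on `U` is a subrepresentation if it is stable under the group. -/
def IsSubrep (ρ : Representation ℂ G U) (W : Submodule ℂ (U → ℂ)) : Prop :=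
  ∀ g : G, ∀ f ∈ W, formAct ρ g f ∈ W

/-- A subrepresentation is irreducible if it is nonzero and has no proper nonzero
subrepresentation. -/
def IsIrredSubrep (ρ : Representation ℂ G U) (W : Submodule ℂ (U → ℂ)) : Prop :=
  IsSubrep ρ W ∧ W ≠ ⊥ ∧
    ∀ W' : Submodule ℂ (U → ℂ), W' ≤ W → IsSubrep ρ W' → W' = ⊥ ∨ W' = W

/-- The group acts faithfully on the subspace `W`. -/
def FaithfulOn (ρ : Representation ℂ G U) (W : Submodule ℂ (U → ℂ)) : Prop :=
  ∀ g : G, (∀ f ∈ W, formAct ρ g f = f) → g = 1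

/-- `W` is a subrepresentation isomorphic to `U` itself:  there is an injective `G`-equivariant
linear map `U → (U → ℂ)` with range `W`. -/
def IsCopyOfU (ρ : Representation ℂ G U) (W : Submodule ℂ (U → ℂ)) : Prop :=
  ∃ e : U →ₗ[ℂ] (U → ℂ), Function.Injective e ∧ LinearMap.range e = W ∧
    ∀ (g : G) (u : U), e (ρ g u) = formAct ρ g⁻¹ (e u)

end SymForms

namespace TA7
open Equiv Equiv.Perm
set_option maxRecDepth 100000

abbrev A7 := alternatingGroup (Fin 7)

def cyc (a : A7) : Multiset ℕ := (a : Perm (Fin 7)).cycleType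

def types : Finset (Multiset ℕ) := {0,{2,2},{3},{3,3},{4,2},{5},{3,2,2},{7}}

theorem cardA7 : Fintype.card A7 = 2520 := by
  have := two_mul_card_alternatingGroup (α := Fin 7)
  rw [Fintype.card_perm, Fintype.card_fin] at this
  have h : Nat.factorial 7 = 5040 := by decide
  rw [h] at this
  unfold A7
  omega

/-- number of elements of a given cycle type -/
def ccl (m : Multiset ℕ) : ℕ := (Finset.univ.filter (fun a : A7 => cyc a = m)).card

theorem cnt (m : Multiset ℕ) (k : ℕ)
    (h1 : (m.sum ≤ 7 ∧ ∀ a ∈ m, 2 ≤ a) ∧ Even (m.sum + Multiset.card m))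
    (h2 : Nat.factorial 7 /
          (Nat.factorial (7 - m.sum) *
            (m.prod * (∏ n ∈ m.toFinset, Nat.factorial (m.count n)))) = k) :
    ccl m = k := by
  have := AlternatingGroup.card_of_cycleType (Fin 7) m
  rw [Fintype.card_fin, if_pos h1, h2] at this
  exact this

theorem cnt0 : ccl 0 = 1 := cnt _ _ (by decide) (by decide)
theorem cnt2 : ccl {2,2} = 105 := cnt _ _ (by decide) (by decide)
theorem cnt3 : ccl {3} = 70 := cnt _ _ (by decide) (by decide)
theorem cnt33 : ccl {3,3} = 280 := cnt _ _ (by decide) (by decide)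
theorem cnt42 : ccl {4,2} = 630 := cnt _ _ (by decide) (by decide)
theorem cnt5 : ccl {5} = 504 := cnt _ _ (by decide) (by decide)
theorem cnt322 : ccl {3,2,2} = 210 := cnt _ _ (by decide) (by decide)
theorem cnt7 : ccl {7} = 720 := cnt _ _ (by decide) (by decide)

theorem sum_types {M : Type*} [AddCommMonoid M] (F : Multiset ℕ → M) :
    ∑ t ∈ types, F t = F 0 + (F {2,2} + (F {3} + (F {3,3} + (F {4,2} + (F {5} + (F {3,2,2} + F {7})))))) := by
  unfold types
  rw [Finset.sum_insert (by decide), Finset.sum_insert (by decide), Finset.sum_insert (by decide),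
    Finset.sum_insert (by decide), Finset.sum_insert (by decide), Finset.sum_insert (by decide),
    Finset.sum_insert (by decide), Finset.sum_singleton]

theorem gen_mem {α β : Type*} [Fintype α] [DecidableEq β] (f : α → β) (T : Finset β)
    (hs : ∑ t ∈ T, (Finset.univ.filter (fun a => f a = t)).card = Fintype.card α) (a : α) :
    f a ∈ T := by
  have h := Finset.card_eq_sum_card_fiberwise (f := f)
    (s := Finset.univ.filter (fun a : α => f a ∈ T)) (t := T)
    (by intro a ha; simpa using ha)
  have h2 : ∀ t ∈ T, ((Finset.univ.filter (fun a : α => f a ∈ T)).filter (fun a => f a = t)).card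
      = (Finset.univ.filter (fun a : α => f a = t)).card := by
    intro t ht
    refine congrArg Finset.card ?_
    ext a
    simp only [Finset.mem_filter, Finset.mem_univ, true_and]
    exact ⟨fun h => h.2, fun h => ⟨h ▸ ht, h⟩⟩
  rw [Finset.sum_congr rfl h2, hs] at h
  have h3 : Finset.univ.filter (fun a : α => f a ∈ T) = Finset.univ :=
    Finset.eq_univ_of_card _ h
  have := Finset.mem_univ a
  rw [← h3] at this
  simpa using this

theorem cyc_mem (a : A7) : cyc a ∈ types := by
  have hh : ∑ t ∈ types, ccl t = 2520 := by
    rw [sum_types, cnt0, cnt2, cnt3, cnt33, cnt42, cnt5, cnt322, cnt7]; norm_num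
  exact gen_mem cyc types (hh.trans cardA7.symm) a

theorem sumA7 (f : A7 → ℂ) (v : Multiset ℕ → ℂ) (hf : ∀ a, f a = v (cyc a)) :
    ∑ a, f a = v 0 + 105 * v {2,2} + 70 * v {3} + 280 * v {3,3} + 630 * v {4,2} + 504 * v {5}
      + 210 * v {3,2,2} + 720 * v {7} := by
  rw [← Finset.sum_fiberwise_of_maps_to (s := Finset.univ) (t := types) (g := cyc)
    (fun a _ => cyc_mem a)]
  have : ∀ t ∈ types, ∑ a ∈ Finset.univ.filter (fun a : A7 => cyc a = t), f a =
      (ccl t : ℂ) * v t := by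
    intro t _
    unfold ccl
    rw [Finset.sum_congr rfl (g := fun _ => v t), Finset.sum_const, nsmul_eq_mul]
    intro a ha
    rw [hf, (Finset.mem_filter.mp ha).2]
  rw [Finset.sum_congr rfl this, sum_types, cnt0, cnt2, cnt3, cnt33, cnt42, cnt5, cnt322, cnt7]
  push_cast
  ring

def r2 : A7 := ⟨c[(0:Fin 7),1] * c[2,3], mem_alternatingGroup.2 (by decide)⟩
def r3 : A7 := ⟨c[(0:Fin 7),1,2], mem_alternatingGroup.2 (by decide)⟩
def r3' : A7 := ⟨c[(3:Fin 7),4,5], mem_alternatingGroup.2 (by decide)⟩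
def r33 : A7 := r3 * r3'
def r42 : A7 := ⟨c[(0:Fin 7),1,2,3] * c[4,5], mem_alternatingGroup.2 (by decide)⟩
def r5 : A7 := ⟨c[(0:Fin 7),1,2,3,4], mem_alternatingGroup.2 (by decide)⟩
def r322 : A7 := ⟨c[(0:Fin 7),1] * c[2,3] * c[4,5,6], mem_alternatingGroup.2 (by decide)⟩
def r7 : A7 := ⟨c[(0:Fin 7),1,2,3,4,5,6], mem_alternatingGroup.2 (by decide)⟩

theorem conj_of (r a : A7) (h : cyc a = cyc r) (d : Perm (Fin 7)) (hd : sign d = -1)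
    (hdr : d * r = r * d) : ∃ c : A7, c * r * c⁻¹ = a := by
  obtain ⟨c, hc⟩ := isConj_iff.1 (isConj_iff_cycleType_eq.2 h.symm)
  rcases Int.units_eq_one_or (sign c) with hs | hs
  · exact ⟨⟨c, hs⟩, Subtype.ext hc⟩
  · refine ⟨⟨c * d, by rw [mem_alternatingGroup, Perm.sign_mul, hs, hd]; rfl⟩, Subtype.ext ?_⟩
    have : c * d * r * (c * d)⁻¹ = (a : Perm (Fin 7)) := by
      rw [mul_assoc c d, hdr, ← hc]; group
    exact this

theorem conj2 (a : A7) (h : cyc a = {2,2}) : ∃ c : A7, c * r2 * c⁻¹ = a :=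
  conj_of r2 a (h.trans (by decide)) c[4,5] (by decide) (by decide)
theorem conj3 (a : A7) (h : cyc a = {3}) : ∃ c : A7, c * r3 * c⁻¹ = a :=
  conj_of r3 a (h.trans (by decide)) c[4,5] (by decide) (by decide)
theorem conj33 (a : A7) (h : cyc a = {3,3}) : ∃ c : A7, c * r33 * c⁻¹ = a :=
  conj_of r33 a (h.trans (by decide)) (c[0,3] * c[1,4] * c[2,5]) (by decide) (by decide)
theorem conj42 (a : A7) (h : cyc a = {4,2}) : ∃ c : A7, c * r42 * c⁻¹ = a :=
  conj_of r42 a (h.trans (by decide)) c[4,5] (by decide) (by decide)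
theorem conj5 (a : A7) (h : cyc a = {5}) : ∃ c : A7, c * r5 * c⁻¹ = a :=
  conj_of r5 a (h.trans (by decide)) c[5,6] (by decide) (by decide)
theorem conj322 (a : A7) (h : cyc a = {3,2,2}) : ∃ c : A7, c * r322 * c⁻¹ = a :=
  conj_of r322 a (h.trans (by decide)) c[0,1] (by decide) (by decide)
theorem conj7 (a : A7) (h : cyc a = {7}) : ∃ c : A7, c * r7 * c⁻¹ = a ∨ c * r7⁻¹ * c⁻¹ = a := by
  have h' : cyc a = cyc r7 := h.trans (by decide)
  obtain ⟨c, hc⟩ := isConj_iff.1 (isConj_iff_cycleType_eq.2 h'.symm)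
  rcases Int.units_eq_one_or (sign c) with hs | hs
  · exact ⟨⟨c, hs⟩, Or.inl (Subtype.ext hc)⟩
  · have hd : sign (c[(1:Fin 7),6] * c[2,5] * c[3,4]) = -1 := by decide
    refine ⟨⟨c * (c[(1:Fin 7),6] * c[2,5] * c[3,4]), by rw [mem_alternatingGroup, Perm.sign_mul, hs, hd]; rfl⟩,
      Or.inr (Subtype.ext ?_)⟩
    have hdr : (c[(1:Fin 7),6] * c[2,5] * c[3,4]) * ((r7 : Perm (Fin 7)))⁻¹ =
      (r7 : Perm (Fin 7)) * (c[(1:Fin 7),6] * c[2,5] * c[3,4]) := by decide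
    have : c * (c[(1:Fin 7),6] * c[2,5] * c[3,4]) * ((r7 : Perm (Fin 7)))⁻¹ *
      (c * (c[(1:Fin 7),6] * c[2,5] * c[3,4]))⁻¹ = (a : Perm (Fin 7)) := by
      rw [mul_assoc c, hdr, ← hc]; group
    exact this

theorem inst_simple : IsSimpleGroup A7 := alternatingGroup.isSimpleGroup (by simp)

-- conjugacy facts
theorem k42 : ∃ c : A7, c * r42 * c⁻¹ = r42⁻¹ := by
  obtain ⟨c, hc⟩ := conj42 r42⁻¹ (by decide)
  exact ⟨c, hc⟩
theorem k42sq : ∃ c : A7, c * r2 * c⁻¹ = r42 ^ 2 := conj2 _ (by decide)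
theorem k3 : ∃ c : A7, c * r3 * c⁻¹ = r3⁻¹ := conj3 _ (by decide)
theorem k33 : ∃ c : A7, c * r33 * c⁻¹ = r33⁻¹ := conj33 _ (by decide)
theorem k322 : ∃ c : A7, c * r322 * c⁻¹ = r322⁻¹ := conj322 _ (by decide)
theorem k322sq : ∃ c : A7, c * r3 * c⁻¹ = r322 ^ 2 := conj3 _ (by decide)
theorem k322cu : ∃ c : A7, c * r2 * c⁻¹ = r322 ^ 3 := conj2 _ (by decide)
theorem k5 : ∃ c : A7, c * r5 * c⁻¹ = r5 ^ 2 := conj5 _ (by decide)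
theorem k7 : ∃ c : A7, c * r7 * c⁻¹ = r7 ^ 2 :=
  ⟨⟨c[(1:Fin 7),2,4] * c[3,6,5], mem_alternatingGroup.2 (by decide)⟩, by decide⟩

theorem p2 : r2 ^ 2 = 1 := by decide
theorem p3 : r3 ^ 3 = 1 := by decide
theorem p33 : r33 ^ 3 = 1 := by decide
theorem p42 : r42 ^ 4 = 1 := by decide
theorem p5 : r5 ^ 5 = 1 := by decide
theorem p322 : r322 ^ 6 = 1 := by decide
theorem p7 : r7 ^ 7 = 1 := by decide

/-- second involution of the Klein four-group -/
def s2 : A7 := ⟨c[(0:Fin 7),2] * c[1,3], mem_alternatingGroup.2 (by decide)⟩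
theorem s2_comm : r2 * s2 = s2 * r2 := by decide
theorem ks2 : ∃ c : A7, c * r2 * c⁻¹ = s2 := conj2 _ (by decide)
theorem krs : ∃ c : A7, c * r2 * c⁻¹ = r2 * s2 := conj2 _ (by decide)
theorem ps2 : s2 ^ 2 = 1 := by decide
theorem r3_comm : r3 * r3' = r3' * r3 := by decide
theorem pr3' : r3' ^ 3 = 1 := by decide

end TA7

namespace TA7
open Equiv Equiv.Perm
open scoped commutatorElement

structure Cov {G : Type} [Group G] (π : G →* A7) : Prop where
  surj : Function.Surjective π
  ker : ∀ g, π g = 1 ↔ g ∈ Subgroup.center G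
  perf : commutator G = ⊤
  cube : ∀ z ∈ Subgroup.center G, z ^ 3 = 1

theorem exists_cov (G : Type) [Group G] 
    (h : commutator G = ⊤ ∧ IsCyclic (Subgroup.center G) ∧ Nat.card (Subgroup.center G) = 3 ∧
    Nonempty (G ⧸ Subgroup.center G ≃* alternatingGroup (Fin 7))) : ∃ π : G →* A7, Cov π := by
  obtain ⟨h1, -, h3, ⟨e⟩⟩ := h
  refine ⟨e.toMonoidHom.comp (QuotientGroup.mk' _), ?_, ?_, h1, ?_⟩
  · exact e.surjective.comp (QuotientGroup.mk'_surjective _)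
  · intro g
    simp
  · intro z hz
    have := pow_card_eq_one' (x := (⟨z, hz⟩ : Subgroup.center G))
    rw [h3] at this
    simpa using congrArg Subtype.val this

variable {G : Type} [Group G] {π : G →* A7}

theorem Cov.eq_mul (C : Cov π) {g h : G} (e : π g = π h) : ∃ z ∈ Subgroup.center G, g = h * z :=
  ⟨h⁻¹ * g, (C.ker _).1 (by simp [e]), by simp⟩

theorem cen {z : G} (hz : z ∈ Subgroup.center G) (g : G) : z * g = g * z :=
  (Subgroup.mem_center_iff.1 hz g).symm

theorem Cov.normal (C : Cov π) (K : Subgroup G) [K.Normal] (g : G) (hg : g ∈ K) (hg1 : π g ≠ 1) :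
    K = ⊤ := by
  have := inst_simple
  have hn : (K.map π).Normal := Subgroup.Normal.map inferInstance π C.surj
  have ht : K.map π = ⊤ := by
    rcases hn.eq_bot_or_eq_top with h | h
    · exfalso
      apply hg1
      have : π g ∈ K.map π := ⟨g, hg, rfl⟩
      rw [h] at this
      simpa using this
    · exact h
  have key : ∀ x : G, ∃ k ∈ K, ∃ z ∈ Subgroup.center G, x = k * z := by
    intro x
    have : π x ∈ K.map π := by rw [ht]; trivial
    obtain ⟨k, hk, e⟩ := this
    obtain ⟨z, hz, e⟩ := C.eq_mul e.symm
    exact ⟨k, hk, z, hz, e⟩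
  rw [eq_top_iff, ← C.perf, commutator_def, Subgroup.commutator_le]
  rintro x - y -
  obtain ⟨k, hk, z, hz, rfl⟩ := key x
  obtain ⟨k', hk', z', hz', rfl⟩ := key y
  have : ⁅k * z, k' * z'⁆ = ⁅k, k'⁆ := by
    rw [commutatorElement_def, commutatorElement_def, mul_inv_rev, mul_inv_rev]
    have h1 := cen hz
    have h2 := cen hz'
    have h1' := cen (inv_mem hz)
    calc k * z * (k' * z') * (z⁻¹ * k⁻¹) * (z'⁻¹ * k'⁻¹)
        = k * (z * (k' * z')) * (z⁻¹ * k⁻¹) * (z'⁻¹ * k'⁻¹) := by group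
      _ = k * k' * (z' * k⁻¹) * (z'⁻¹ * k'⁻¹) := by rw [h1]; group
      _ = k * k' * k⁻¹ * k'⁻¹ := by rw [h2]; group
  rw [this, commutatorElement_def]
  exact K.mul_mem (K.mul_mem (K.mul_mem hk hk') (K.inv_mem hk)) (K.inv_mem hk')

/-- powers and central elements -/
theorem mul_cen_pow {z : G} (hz : z ∈ Subgroup.center G) (g : G) (n : ℕ) :
    (g * z) ^ n = g ^ n * z ^ n := (show Commute g z from (cen hz g).symm).mul_pow n

theorem Cov.pow_cen (C : Cov π) {g : G} {n : ℕ} (h : π g ^ n = 1) : g ^ n ∈ Subgroup.center G :=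
  (C.ker _).1 (by simpa using h)

theorem Cov.lift (C : Cov π) (r : A7) (n j : ℕ) (hr : r ^ n = 1) (hj : r ^ (3 * j) = r) :
    ∃ g, π g = r ∧ g ^ n = 1 := by
  obtain ⟨g, rfl⟩ := C.surj r
  refine ⟨g ^ (3 * j), by simpa using hj, ?_⟩
  rw [← pow_mul, mul_comm, pow_mul, pow_mul, C.cube _ (C.pow_cen hr), one_pow]

theorem one_of_pow {z : G} {n : ℕ} (h3 : z ^ 3 = 1) (hn : Nat.Coprime n 3) (h : z ^ n = 1) : z = 1 := by
  have h1 := orderOf_dvd_of_pow_eq_one h3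
  have h2 := orderOf_dvd_of_pow_eq_one h
  have := Nat.dvd_gcd h2 h1
  rw [hn] at this
  exact orderOf_eq_one_iff.1 (Nat.dvd_one.1 this)

theorem Cov.conj (C : Cov π) {g h : G} {n : ℕ} (hn : Nat.Coprime n 3) (hg : g ^ n = 1)
    (hh : h ^ n = 1) (hc : ∃ c, c * π g * c⁻¹ = π h) : ∃ x, x * g * x⁻¹ = h := by
  obtain ⟨c, hc⟩ := hc
  obtain ⟨x, rfl⟩ := C.surj c
  have : π (x * g * x⁻¹) = π h := by simpa using hc
  obtain ⟨z, hz, e⟩ := C.eq_mul this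
  refine ⟨x, ?_⟩
  have hp : (x * g * x⁻¹) ^ n = 1 := by rw [conj_pow, hg]; simp
  rw [e, mul_cen_pow hz, hh, one_mul] at hp
  rw [e, one_of_pow (C.cube z hz) hn hp, mul_one]

theorem Cov.real_lift (C : Cov π) (r : A7) (n : ℕ) (hr : r ^ n = 1) (hc : ∃ c, c * r * c⁻¹ = r⁻¹) :
    ∃ g, π g = r ∧ g ^ n = 1 ∧ ∃ x, x * g * x⁻¹ = g⁻¹ := by
  obtain ⟨g, rfl⟩ := C.surj r
  obtain ⟨c, hc⟩ := hc
  obtain ⟨x, rfl⟩ := C.surj c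
  have : π (x * g * x⁻¹) = π g⁻¹ := by simpa using hc
  obtain ⟨z, hz, e⟩ := C.eq_mul this
  have hz3 := C.cube z hz
  have hreal : x * (g * z) * x⁻¹ = (g * z)⁻¹ := by
    have h1 : x * (g * z) * x⁻¹ = x * g * x⁻¹ * z := by
      have := cen hz x⁻¹
      calc x * (g * z) * x⁻¹ = x * g * (z * x⁻¹) := by group
        _ = _ := by rw [this]; group
    rw [h1, e, mul_inv_rev, cen (inv_mem hz), mul_assoc]
    congr 1
    rw [eq_inv_iff_mul_eq_one, ← hz3, pow_succ, pow_two]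
  have hπ : π (g * z) = π g := by simp [(C.ker z).2 hz]
  refine ⟨g * z, hπ, ?_, x, hreal⟩
  have hcen : (g * z) ^ n ∈ Subgroup.center G := C.pow_cen (by rw [hπ]; exact hr)
  have h1 : x * (g * z) ^ n * x⁻¹ = ((g * z) ^ n)⁻¹ := by
    rw [← conj_pow, hreal, inv_pow]
  rw [← cen hcen, mul_assoc, mul_inv_cancel, mul_one, eq_inv_iff_mul_eq_one, ← pow_two] at h1
  exact one_of_pow (C.cube _ hcen) (by norm_num) h1

theorem Cov.comm_lift (C : Cov π) {g h : G} (hg : g ^ 2 = 1) (e : π g * π h = π h * π g)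
    (hh : h ^ 2 = 1) : g * h = h * g := by
  have : π (g * h) = π (h * g) := by simpa using e
  obtain ⟨z, hz, e⟩ := C.eq_mul this
  have h1 : (h * z) ^ 2 = 1 := by
    have : h * z = g * h * g⁻¹ := by
      rw [e, mul_assoc (h * g), cen hz]; group
    rw [this, conj_pow, hh]; simp
  rw [mul_cen_pow hz, hh, one_mul] at h1
  rw [e, one_of_pow (C.cube z hz) (by norm_num) h1, mul_one]

/-- the order nine subgroup -/
def S9 : Finset A7 := Finset.univ.image (fun p : Fin 3 × Fin 3 => r3 ^ (p.1 : ℕ) * r3' ^ (p.2 : ℕ))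

set_option maxRecDepth 100000 in
theorem S9_card : S9.card = 9 := by decide

theorem S9_mem (a : A7) : a ∈ S9 ↔ ∃ i j : ℕ, a = r3 ^ i * r3' ^ j := by
  simp only [S9, Finset.mem_image, Finset.mem_univ, true_and, Prod.exists]
  constructor
  · rintro ⟨i, j, rfl⟩
    exact ⟨_, _, rfl⟩
  · rintro ⟨i, j, rfl⟩
    refine ⟨⟨i % 3, Nat.mod_lt _ (by norm_num)⟩, ⟨j % 3, Nat.mod_lt _ (by norm_num)⟩, ?_⟩
    rw [pow_eq_pow_mod i p3, pow_eq_pow_mod j pr3']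

def M9 : Subgroup A7 where
  carrier := {a | a ∈ S9}
  mul_mem' := by
    intro a b ha hb
    obtain ⟨i, j, rfl⟩ := (S9_mem a).1 ha
    obtain ⟨i', j', rfl⟩ := (S9_mem b).1 hb
    refine (S9_mem _).2 ⟨i + i', j + j', ?_⟩
    have hc : Commute r3 r3' := r3_comm
    rw [pow_add, pow_add, mul_assoc, ← mul_assoc (r3' ^ j), ← (hc.pow_pow i' j).eq]
    group
  one_mem' := (S9_mem _).2 ⟨0, 0, by simp⟩
  inv_mem' := by
    intro a ha
    obtain ⟨i, j, rfl⟩ := (S9_mem a).1 ha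
    refine (S9_mem _).2 ⟨2 * i, 2 * j, ?_⟩
    have hc : Commute r3 r3' := r3_comm
    have h3 : r3⁻¹ = r3 ^ 2 := by rw [inv_eq_iff_mul_eq_one, ← pow_succ', p3]
    have h3' : r3'⁻¹ = r3' ^ 2 := by rw [inv_eq_iff_mul_eq_one, ← pow_succ', pr3']
    rw [(hc.pow_pow i j).eq, mul_inv_rev, ← inv_pow, ← inv_pow, h3, h3', pow_mul, pow_mul]

theorem M9_index : M9.index = 280 := by
  have h := M9.card_mul_index
  have h1 : Nat.card M9 = 9 := by
    have : Nat.card M9 = Nat.card S9 := Nat.card_congr (Equiv.refl _)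
    rw [this, Nat.card_eq_fintype_card, Fintype.card_coe, S9_card]
  rw [h1, Nat.card_eq_fintype_card, cardA7] at h
  omega

open scoped IsMulCommutative in
theorem Cov.not_comm (C : Cov π) {P Q : G} (hz : ∃ z ∈ Subgroup.center G, z ≠ 1)
    (hP : π P = r3) (hQ : π Q = r3') : P * Q ≠ Q * P := by
  intro hPQ
  obtain ⟨z, hz, hz1⟩ := hz
  apply hz1
  let H : Subgroup G := M9.comap π
  have hi : H.index = 280 := by
    rw [Subgroup.index_comap_of_surjective _ C.surj, M9_index]
  have hel : ∀ h ∈ H, ∃ i j : ℕ, ∃ y ∈ Subgroup.center G, h = P ^ i * Q ^ j * y := by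
    intro h hh
    have : π h ∈ S9 := hh
    simp only [S9, Finset.mem_image, Finset.mem_univ, true_and] at this
    obtain ⟨p, hp⟩ := this
    obtain ⟨y, hy, e⟩ := C.eq_mul (g := h) (h := P ^ (p.1 : ℕ) * Q ^ (p.2 : ℕ)) (by simp [hP, hQ, hp])
    exact ⟨_, _, y, hy, e⟩
  have hcomm : IsMulCommutative H := by
    constructor; constructor
    rintro ⟨a, ha⟩ ⟨b, hb⟩
    apply Subtype.ext
    change a * b = b * a
    obtain ⟨i, j, y, hy, rfl⟩ := hel a ha
    obtain ⟨i', j', y', hy', rfl⟩ := hel b hb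
    have c0 : Commute P Q := hPQ
    have cy : ∀ g, Commute y g := fun g => cen hy g
    have cy' : ∀ g, Commute g y' := fun g => (cen hy' g).symm
    have cQP : Commute Q P := c0.symm
    refine Commute.mul_left ?_ (cy _)
    refine Commute.mul_right ?_ (cy' _)
    refine Commute.mul_left ?_ ?_
    · exact Commute.mul_right ((Commute.refl P).pow_pow _ _) (c0.pow_pow _ _)
    · exact Commute.mul_right (cQP.pow_pow _ _) ((Commute.refl Q).pow_pow _ _)
  have hfi : H.FiniteIndex := ⟨by rw [hi]; norm_num⟩
  have ht := MonoidHom.transfer_eq_pow (MonoidHom.id H) z (by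
    intro k g₀ _
    rw [← cen ((Subgroup.center G).inv_mem ((Subgroup.center G).pow_mem hz k)) g₀⁻¹ |> fun _ => (cen ((Subgroup.center G).pow_mem hz k) g₀⁻¹)]
    group)
  have hker : z ∈ (MonoidHom.transfer (MonoidHom.id H)).ker := by
    apply Abelianization.commutator_subset_ker
    rw [C.perf]; trivial
  rw [MonoidHom.mem_ker.1 hker] at ht
  have := congrArg Subtype.val ht
  simp only [MonoidHom.id_apply, hi] at this
  exact one_of_pow (C.cube z hz) (n := 280) (by norm_num) this.symm

end TA7

namespace TA7
section LA
variable {V : Type*} [AddCommGroup V] [Module ℂ V] [FiniteDimensional ℂ V]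

theorem idem_trace (E : Module.End ℂ V) (h : E * E = E) : ∃ m : ℕ, LinearMap.trace ℂ V E = m := by
  have hE : IsIdempotentElem E := h
  exact ⟨_, (LinearMap.IsIdempotentElem.isProj_range E hE).trace⟩

theorem avg_idem (B : Module.End ℂ V) (n : ℕ) (hn : n ≠ 0) (hB : B ^ n = 1) :
    ∃ E : Module.End ℂ V, E * E = E ∧ B * E = E ∧
      (n : ℂ) • E = ∑ k ∈ Finset.range n, B ^ k := by
  have hn' : (n : ℂ) ≠ 0 := by exact_mod_cast hn
  set S : Module.End ℂ V := ∑ k ∈ Finset.range n, B ^ k with hS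
  have hBS : B * S = S := by
    rw [hS, Finset.mul_sum]
    have h1 := Finset.sum_range_succ (fun k => B ^ k) n
    have h2 := Finset.sum_range_succ' (fun k => B ^ k) n
    rw [h1, hB, pow_zero] at h2
    have := add_right_cancel h2
    rw [this]
    exact Finset.sum_congr rfl (fun k _ => (pow_succ' B k).symm)
  have hkS : ∀ k, B ^ k * S = S := by
    intro k
    induction k with
    | zero => simp
    | succ k ih => rw [pow_succ, mul_assoc, hBS, ih]
  have hSS : S * S = (n : ℂ) • S := by
    conv_lhs => rw [hS, Finset.sum_mul]
    rw [← hS, Finset.sum_congr rfl (fun k _ => hkS k)]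
    simp [Nat.cast_smul_eq_nsmul]
  refine ⟨(n : ℂ)⁻¹ • S, ?_, ?_, ?_⟩
  · rw [smul_mul_smul_comm, hSS, smul_smul]
    congr 1
    field_simp
  · rw [mul_smul_comm, hBS]
  · rw [smul_smul, mul_inv_cancel₀ hn', one_smul]

theorem mult (B : Module.End ℂ V) (n : ℕ) (hn : n ≠ 0) (hB : B ^ n = 1) :
    ∃ m : ℕ, ∑ k ∈ Finset.range n, LinearMap.trace ℂ V (B ^ k) = n * m ∧
      (m = Module.finrank ℂ V → B = 1) := by
  obtain ⟨E, h1, h2, h3⟩ := avg_idem B n hn hB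
  obtain ⟨m, hm⟩ := idem_trace E h1
  refine ⟨m, ?_, ?_⟩
  · rw [← map_sum, ← h3, map_smul, hm, smul_eq_mul]
  · intro hd
    have h4 : IsIdempotentElem (1 - E) := IsIdempotentElem.one_sub h1
    have h5 : LinearMap.trace ℂ V (1 - E) = 0 := by
      rw [map_sub, hm, LinearMap.trace_one, hd, sub_self]
    have h6 := (LinearMap.IsIdempotentElem.trace_eq_zero_iff h4).1 h5
    rw [sub_eq_zero] at h6
    rw [← h6, mul_one] at h2
    exact h2

theorem mult_z (A : Module.End ℂ V) (ζ : ℂ) (n : ℕ) (hn : n ≠ 0) (hA : A ^ n = 1) (hz : ζ ^ n = 1) :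
    ∃ m : ℕ, ∑ k ∈ Finset.range n, ζ ^ k * LinearMap.trace ℂ V (A ^ k) = n * m := by
  obtain ⟨m, hm, -⟩ := mult (ζ • A) n hn (by rw [smul_pow, hA, hz, one_smul])
  refine ⟨m, ?_⟩
  rw [← hm]
  refine Finset.sum_congr rfl (fun k _ => ?_)
  rw [smul_pow, map_smul, smul_eq_mul]

theorem mult_v4 (A B : Module.End ℂ V) (hA : A ^ 2 = 1) (hB : B ^ 2 = 1) (hc : A * B = B * A) :
    ∃ m : ℕ, (Module.finrank ℂ V : ℂ) + LinearMap.trace ℂ V A + LinearMap.trace ℂ V B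
      + LinearMap.trace ℂ V (A * B) = 4 * m := by
  rw [pow_two] at hA hB
  set S := 1 + A + B + A * B with hS
  have hAS : A * S = S := by
    rw [hS]; simp only [mul_add, mul_one, ← mul_assoc, hA, one_mul]; abel
  have hBS : B * S = S := by
    rw [hS]; simp only [mul_add, mul_one, ← mul_assoc, hB, one_mul, ← hc]
    rw [mul_assoc, hB, mul_one]; abel
  have hSS : S * S = (4 : ℂ) • S := by
    conv_lhs => rw [hS]
    rw [add_mul, add_mul, add_mul, mul_assoc, hBS, hAS, one_mul]
    have : (4 : ℂ) = 1 + 1 + 1 + 1 := by norm_num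
    rw [this]; simp only [add_smul, one_smul]
    rw [← hS]
  obtain ⟨m, hm⟩ := idem_trace ((4 : ℂ)⁻¹ • S) (by
    rw [smul_mul_smul_comm, hSS, smul_smul]
    congr 1
    norm_num)
  refine ⟨m, ?_⟩
  rw [← hm, map_smul, hS]
  simp only [map_add, LinearMap.trace_one, smul_eq_mul]
  ring
end LA

structure Sys {G : Type} [Group G] (π : G →* A7) where
  (g2 g3 g33 g42 g5 g6 g7 s : G)
  c2 : cyc (π g2) = {2,2}
  c3 : cyc (π g3) = {3}
  c33 : cyc (π g33) = {3,3}
  c42 : cyc (π g42) = {4,2}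
  c5 : cyc (π g5) = {5}
  c6 : cyc (π g6) = {3,2,2}
  c7 : π g7 = r7
  o2 : g2 ^ 2 = 1
  o3 : g3 ^ 3 = 1
  i3 : IsConj g3 g3⁻¹
  o33 : g33 ^ 3 = 1
  i33 : IsConj g33 g33⁻¹
  o42 : g42 ^ 4 = 1
  i42 : IsConj g42 g42⁻¹
  q42 : IsConj g2 (g42 ^ 2)
  o5 : g5 ^ 5 = 1
  q5 : IsConj g5 (g5 ^ 2)
  o6 : g6 ^ 6 = 1
  i6 : IsConj g6 g6⁻¹
  q6 : g6 ^ 2 = g3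
  t6 : g6 ^ 3 = g2
  o7 : g7 ^ 7 = 1
  q7 : IsConj g7 (g7 ^ 2)
  os : s ^ 2 = 1
  cs : g2 * s = s * g2
  is : IsConj g2 s
  i2s : IsConj g2 (g2 * s)

variable {G : Type} [Group G] {π : G →* A7}

set_option maxRecDepth 100000 in
theorem Cov.sys (C : Cov π) : Nonempty (Sys π) := by
  obtain ⟨g6, e6, o6, i6⟩ := C.real_lift r322 6 p322 k322
  obtain ⟨g33, e33, o33, i33⟩ := C.real_lift r33 3 p33 k33
  obtain ⟨g42, e42, o42, i42⟩ := C.real_lift r42 4 p42 k42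
  obtain ⟨g5, e5, o5⟩ := C.lift r5 5 2 p5 (by decide)
  obtain ⟨g7, e7, o7⟩ := C.lift r7 7 5 p7 (by decide)
  obtain ⟨s, es, os⟩ := C.lift s2 2 1 ps2 (by decide)
  have o2 : (g6 ^ 3) ^ 2 = 1 := by rw [← pow_mul, o6]
  have e2 : π (g6 ^ 3) = r2 := by rw [map_pow, e6]; decide
  have cs : g6 ^ 3 * s = s * g6 ^ 3 := C.comm_lift o2 (by rw [e2, es]; exact s2_comm) os
  have i6' : IsConj g6 g6⁻¹ := isConj_iff.2 i6
  exact ⟨{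
    g2 := g6 ^ 3, g3 := g6 ^ 2, g33 := g33, g42 := g42, g5 := g5, g6 := g6, g7 := g7, s := s
    c2 := by rw [e2]; decide
    c3 := by rw [map_pow, e6]; decide
    c33 := by rw [e33]; decide
    c42 := by rw [e42]; decide
    c5 := by rw [e5]; decide
    c6 := by rw [e6]; decide
    c7 := e7
    o2 := o2
    o3 := by rw [← pow_mul, o6]
    i3 := by
      rw [← inv_pow]
      obtain ⟨x, hx⟩ := i6
      exact isConj_iff.2 ⟨x, by rw [← conj_pow, hx]⟩
    o33 := o33
    i33 := isConj_iff.2 i33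
    o42 := o42
    i42 := isConj_iff.2 i42
    q42 := isConj_iff.2 (C.conj (n := 2) (by norm_num) o2 (by rw [← pow_mul, o42])
      (by rw [e2, map_pow, e42]; exact k42sq))
    o5 := o5
    q5 := isConj_iff.2 (C.conj (n := 5) (by norm_num) o5 (by rw [← pow_mul, mul_comm, pow_mul, o5, one_pow])
      (by rw [map_pow, e5]; exact k5))
    o6 := o6
    i6 := i6'
    q6 := rfl
    t6 := rfl
    o7 := o7
    q7 := isConj_iff.2 (C.conj (n := 7) (by norm_num) o7 (by rw [← pow_mul, mul_comm, pow_mul, o7, one_pow])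
      (by rw [map_pow, e7]; exact k7))
    os := os
    cs := cs
    is := isConj_iff.2 (C.conj (n := 2) (by norm_num) o2 os (by rw [e2, es]; exact ks2))
    i2s := isConj_iff.2 (C.conj (n := 2) (by norm_num) o2
      (by rw [(show Commute (g6 ^ 3) s from cs).mul_pow, o2, os, one_mul])
      (by rw [map_mul, e2, es]; exact krs)) }⟩

theorem cyc_zero {a : A7} (h : cyc a = 0) : a = 1 :=
  Subtype.ext (Equiv.Perm.cycleType_eq_zero.1 h)

/-- averaging a central class function over `G` -/
theorem Cov.avg [Fintype G] (C : Cov π) (S : Sys π) (F : G → ℂ) (hF : ∀ g h, F (h * g * h⁻¹) = F g)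
    (hz : ∀ g, ∀ z ∈ Subgroup.center G, F (g * z) = F g) (h7 : F S.g7⁻¹ = F S.g7) :
    (Nat.card G : ℂ)⁻¹ * ∑ g, F g = (F 1 + 105 * F S.g2 + 70 * F S.g3 + 280 * F S.g33
      + 630 * F S.g42 + 504 * F S.g5 + 210 * F S.g6 + 720 * F S.g7) / 2520 := by
  classical
  have hdep : ∀ g h, π g = π h → F g = F h := by
    intro g h e
    obtain ⟨z, hz', rfl⟩ := C.eq_mul e
    exact hz _ _ hz'
  have hconj : ∀ g h, (∃ c, c * π g * c⁻¹ = π h) → F g = F h := by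
    rintro g h ⟨c, hc⟩
    obtain ⟨x, rfl⟩ := C.surj c
    rw [← hF g x]
    exact hdep _ _ (by simpa using hc)
  have hcj2 : ∀ (r : A7) (g h : G), (∃ c, c * r * c⁻¹ = π g) → (∃ c, c * r * c⁻¹ = π h) → F g = F h := by
    rintro r g h ⟨c, hc⟩ ⟨d, hd⟩
    obtain ⟨x, rfl⟩ := C.surj r
    rw [← hconj x g ⟨c, hc⟩, ← hconj x h ⟨d, hd⟩]
  choose sec hsec using C.surj
  let f : A7 → ℂ := fun a => F (sec a)
  have hf : ∀ g, F g = f (π g) := fun g => hdep _ _ (hsec _).symm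
  let v : Multiset ℕ → ℂ := fun t => if t = 0 then F 1 else if t = {2,2} then F S.g2 else
    if t = {3} then F S.g3 else if t = {3,3} then F S.g33 else if t = {4,2} then F S.g42 else
    if t = {5} then F S.g5 else if t = {3,2,2} then F S.g6 else F S.g7
  have hv : ∀ a, f a = v (cyc a) := by
    intro a
    have hm := cyc_mem a
    simp only [types, Finset.mem_insert, Finset.mem_singleton] at hm
    have e := hsec a
    rcases hm with h | h | h | h | h | h | h | h <;> rw [h]
    · change F (sec a) = F 1
      exact hdep _ _ (by rw [e, map_one, cyc_zero h])
    · change F (sec a) = F S.g2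
      exact hcj2 r2 _ _ (by rw [e]; exact conj2 a h) (conj2 _ S.c2)
    · change F (sec a) = F S.g3
      exact hcj2 r3 _ _ (by rw [e]; exact conj3 a h) (conj3 _ S.c3)
    · change F (sec a) = F S.g33
      exact hcj2 r33 _ _ (by rw [e]; exact conj33 a h) (conj33 _ S.c33)
    · change F (sec a) = F S.g42
      exact hcj2 r42 _ _ (by rw [e]; exact conj42 a h) (conj42 _ S.c42)
    · change F (sec a) = F S.g5
      exact hcj2 r5 _ _ (by rw [e]; exact conj5 a h) (conj5 _ S.c5)
    · change F (sec a) = F S.g6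
      exact hcj2 r322 _ _ (by rw [e]; exact conj322 a h) (conj322 _ S.c6)
    · change F (sec a) = F S.g7
      obtain ⟨c, hc | hc⟩ := conj7 a h
      · exact (hconj _ _ ⟨c, by rw [S.c7, e, hc]⟩).symm
      · rw [← h7]
        exact (hconj _ _ ⟨c, by rw [map_inv, S.c7, e, hc]⟩).symm
  have hfib : ∀ (k : A7 → ℂ), ∑ g : G, k (π g) =
      ((Finset.univ.filter (fun g => π g = 1)).card : ℂ) * ∑ a, k a := by
    intro k
    rw [← Finset.sum_fiberwise_of_maps_to (s := Finset.univ) (t := (Finset.univ : Finset A7))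
      (g := π) (fun a _ => Finset.mem_univ _), Finset.mul_sum]
    refine Finset.sum_congr rfl (fun a _ => ?_)
    rw [Finset.sum_congr rfl (g := fun _ => k a), Finset.sum_const, nsmul_eq_mul,
      MonoidHom.card_fiber_eq_of_mem_range π (x := a) (y := 1) (C.surj a) ⟨1, map_one π⟩]
    intro g hg
    rw [(Finset.mem_filter.mp hg).2]
  have hcard := hfib (fun _ => 1)
  simp only [Finset.sum_const, nsmul_eq_mul, mul_one, Finset.card_univ, cardA7] at hcard
  have hsum := hfib f
  rw [sumA7 f v hv] at hsum
  have hval : v 0 = F 1 ∧ v {2,2} = F S.g2 ∧ v {3} = F S.g3 ∧ v {3,3} = F S.g33 ∧ v {4,2} = F S.g42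
    ∧ v {5} = F S.g5 ∧ v {3,2,2} = F S.g6 ∧ v {7} = F S.g7 :=
    ⟨rfl, rfl, rfl, rfl, rfl, rfl, rfl, rfl⟩
  obtain ⟨h0, h2, h3, h33, h42, h5, h6, h7'⟩ := hval
  rw [h0, h2, h3, h33, h42, h5, h6, h7'] at hsum
  rw [Finset.sum_congr rfl (fun g _ => hf g), hsum, Nat.card_eq_fintype_card, hcard]
  have hne : ((Finset.univ.filter (fun g => π g = 1)).card : ℂ) ≠ 0 := by
    intro h0
    rw [h0, zero_mul] at hcard
    exact Fintype.card_ne_zero (α := G) (by exact_mod_cast hcard)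
  push_cast
  field_simp

end TA7

namespace TA7
open Representation

set_option linter.unusedSectionVars false
section Irr
variable {G : Type} [Group G] {U : Type*} [AddCommGroup U] [Module ℂ U] [FiniteDimensional ℂ U]

/-- irreducibility, elementary form -/
def Irr (ρ : Representation ℂ G U) : Prop :=
  ∀ W : Submodule ℂ U, (∀ g : G, ∀ v ∈ W, ρ g v ∈ W) → W = ⊥ ∨ W = ⊤

theorem schur {ρ : Representation ℂ G U} (hirr : Irr ρ) [Nontrivial U] (A : Module.End ℂ U)
    (hA : ∀ g v, A (ρ g v) = ρ g (A v)) : ∃ c : ℂ, ∀ v, A v = c • v := by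
  obtain ⟨c, hc⟩ := Module.End.exists_eigenvalue A
  refine ⟨c, ?_⟩
  rcases hirr (Module.End.eigenspace A c) (fun g v hv => by
    rw [Module.End.mem_eigenspace_iff] at hv ⊢
    rw [hA, hv, map_smul]) with h | h
  · exact absurd h hc
  · intro v
    exact Module.End.mem_eigenspace_iff.1 (h ▸ Submodule.mem_top)

theorem Irr.inst {ρ : Representation ℂ G U} (hirr : Irr ρ) [Nontrivial U] : IsIrreducible ρ where
  exists_pair_ne := ⟨⊥, ⊤, fun h => by
    have := congrArg Subrepresentation.toSubmodule h
    exact bot_ne_top this⟩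
  eq_bot_or_eq_top W := by
    rcases hirr W.toSubmodule (fun g v hv => W.apply_mem_toSubmodule g hv) with h | h
    · left; exact Subrepresentation.toSubmodule_injective h
    · right; exact Subrepresentation.toSubmodule_injective h

theorem char_isConj (ρ : Representation ℂ G U) {g h : G} (e : IsConj g h) :
    ρ.character g = ρ.character h := by
  obtain ⟨c, rfl⟩ := isConj_iff.1 e
  exact (char_conj ρ g c).symm

end Irr

section Main
variable {G : Type} [Group G] {π : G →* A7}

theorem Sys.isConj_inv (S : Sys π) : IsConj S.g2 S.g2⁻¹ ∧ IsConj S.g3 S.g3⁻¹ ∧ IsConj S.g33 S.g33⁻¹ ∧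
    IsConj S.g42 S.g42⁻¹ ∧ IsConj S.g5 S.g5⁻¹ ∧ IsConj S.g6 S.g6⁻¹ := by
  refine ⟨?_, S.i3, S.i33, S.i42, ?_, S.i6⟩
  · rw [inv_eq_of_mul_eq_one_right (by rw [← pow_two]; exact S.o2)]
  · have h1 := S.q5
    have h2 : IsConj (S.g5 ^ 2) (S.g5 ^ 4) := by
      obtain ⟨x, hx⟩ := isConj_iff.1 S.q5
      exact isConj_iff.2 ⟨x, by rw [← conj_pow, hx, ← pow_mul]⟩
    have : S.g5⁻¹ = S.g5 ^ 4 := inv_eq_of_mul_eq_one_right (by rw [← pow_succ']; exact S.o5)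
    rw [this]
    exact h1.trans h2

variable {U : Type*} [AddCommGroup U] [Module ℂ U] [FiniteDimensional ℂ U] {ρ : Representation ℂ G U}

theorem Cov.scalar (C : Cov π) [Nontrivial U] (hirr : Irr ρ) {z : G} (hz : z ∈ Subgroup.center G) :
    ∃ c : ℂ, c ^ 3 = 1 ∧ ρ z = c • 1 := by
  obtain ⟨c, hc⟩ := schur hirr (ρ z) (fun g v => by
    rw [← Module.End.mul_apply, ← Module.End.mul_apply, ← map_mul, ← map_mul, cen hz])
  have e : ρ z = c • 1 := by ext v; simp [hc]
  refine ⟨c, ?_, e⟩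
  have h3 : ρ z ^ 3 = 1 := by rw [← map_pow, C.cube z hz, map_one]
  rw [e, smul_pow, one_pow] at h3
  obtain ⟨v, hv⟩ := exists_ne (0 : U)
  have := congrArg (fun f : Module.End ℂ U => f v) h3
  simp only [LinearMap.smul_apply, Module.End.one_apply] at this
  have h4 : (c ^ 3 - 1) • v = 0 := by rw [sub_smul, this, one_smul, sub_self]
  rcases smul_eq_zero.1 h4 with h | h
  · exact sub_eq_zero.1 h
  · exact absurd h hv

theorem Cov.ker_le (C : Cov π) (hdim : 1 < Module.finrank ℂ U) (hirr : Irr ρ) {g : G} (hg : ρ g = 1) :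
    π g = 1 := by
  by_contra h
  have hk := C.normal (MonoidHom.ker (show G →* Module.End ℂ U from ρ)) g (by simpa [MonoidHom.mem_ker] using hg) h
  have htriv : ∀ x, ρ x = 1 := fun x => by
    have : x ∈ MonoidHom.ker (show G →* Module.End ℂ U from ρ) := hk ▸ Subgroup.mem_top x
    exact this
  have : Nontrivial U := (Module.finrank_pos_iff (R := ℂ)).1 (by omega)
  obtain ⟨v, hv⟩ := exists_ne (0 : U)
  rcases hirr (ℂ ∙ v) (fun g w hw => by rw [htriv]; exact hw) with h | h
  · exact hv (Submodule.span_singleton_eq_bot.1 h)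
  · have h1 := finrank_span_singleton (K := ℂ) hv
    rw [h, finrank_top] at h1
    omega

theorem Cov.char_cen (C : Cov π) [Nontrivial U] (hirr : Irr ρ) {z : G} (hz : z ∈ Subgroup.center G) :
    ∃ c : ℂ, c ^ 3 = 1 ∧ ∀ g, ρ (g * z) = c • ρ g ∧ ρ ((g * z)⁻¹) = c⁻¹ • ρ g⁻¹ := by
  obtain ⟨c, h3, e⟩ := C.scalar hirr hz
  have hc : c ≠ 0 := by rintro rfl; norm_num at h3
  refine ⟨c, h3, fun g => ⟨by rw [map_mul, e, mul_smul_comm, mul_one], ?_⟩⟩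
  have : ρ z * ρ z⁻¹ = 1 := by rw [← map_mul, mul_inv_cancel, map_one]
  have h2 : ρ z⁻¹ = c⁻¹ • 1 := by
    rw [e, smul_mul_assoc, one_mul] at this
    rw [← this, smul_smul, inv_mul_cancel₀ hc, one_smul]
  rw [mul_inv_rev, map_mul, h2, smul_mul_assoc, one_mul]

end Main

end TA7

namespace TA7
open Representation
section Main
variable {G : Type} [Group G] {π : G →* A7}
variable {U : Type*} [AddCommGroup U] [Module ℂ U] [FiniteDimensional ℂ U] {ρ : Representation ℂ G U}

theorem num_aux (a b c d f : ℤ) (p2 p3 p33 q : ℤ) (m : ℕ) (ha : a = 6 - 2 * p2) (hv : 3 * a + 6 = 4 * p3)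
    (hb : b = 6 - 3 * p33) (hc : ∃ r, c = 6 - 3 * r) (hd : 6 + 2 * d + a = 4 * q)
    (hn : 36 + 105*a^2 + 70*b^2+280*c^2+630*d^2+504+210*f^2+720 = 2520)
    (h3 : 216 + 105*a^3 + 70*b^3+280*c^3+630*d^3+504+210*f^3-720 = 2520*m) :
    a = 2 ∧ c = 0 ∧ d = 0 ∧ ((b = 3 ∧ f = -1) ∨ (b = 0 ∧ f = 2)) := by
  obtain ⟨r, hc⟩ := hc
  have ha1 : a ≤ 3 := by nlinarith [sq_nonneg b, sq_nonneg c, sq_nonneg d, sq_nonneg f]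
  have ha2 : -3 ≤ a := by nlinarith [sq_nonneg b, sq_nonneg c, sq_nonneg d, sq_nonneg f]
  have ha3 : a = 2 ∨ a = -2 := by omega
  have ha4 : a ^ 2 = 4 := by rcases ha3 with h | h <;> rw [h] <;> norm_num
  have hc1 : c ≤ 2 := by nlinarith [sq_nonneg b, sq_nonneg d, sq_nonneg f]
  have hc2 : -2 ≤ c := by nlinarith [sq_nonneg b, sq_nonneg d, sq_nonneg f]
  have hc3 : c = 0 := by omega
  subst hc3
  have hd1 : d ≤ 1 := by nlinarith [sq_nonneg b, sq_nonneg f]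
  have hd2 : -1 ≤ d := by nlinarith [sq_nonneg b, sq_nonneg f]
  have hd3 : d = 0 := by omega
  subst hd3
  have hb1 : b ≤ 3 := by nlinarith [sq_nonneg f]
  have hb2 : -3 ≤ b := by nlinarith [sq_nonneg f]
  have hb3 : b = 0 ∨ b = 3 ∨ b = -3 := by omega
  have hf1 : f ≤ 2 := by nlinarith [sq_nonneg b]
  have hf2 : -2 ≤ f := by nlinarith [sq_nonneg b]
  rcases ha3 with rfl | rfl <;> rcases hb3 with rfl | rfl | rfl <;> interval_cases f <;>
    first | (norm_num; done) | (exfalso; norm_num at hn; done) | (exfalso; norm_num at h3; done) | (exfalso; norm_num at h3; omega)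

theorem sev_aux (x y : ℂ) (m0 m1 m3 : ℕ) (θ θ' : ℂ) (h1 : θ + θ' = -1) (h2 : θ * θ' = 2)
    (e0 : 6 + 3 * x + 3 * y = 7 * m0) (e1 : 6 + x * θ + y * θ' = 7 * m1) (e3 : 6 + x * θ' + y * θ = 7 * m3)
    (hm0 : m0 ≠ 6) : (x = -1 ∧ y = -1) ∨ x * y = 8 := by
  have hs : x + y = 12 - 7 * (m1 + m3) := by linear_combination -e1 - e3 + (x + y) * h1
  have hd : (x - y) ^ 2 = -7 * ((m1 : ℂ) - m3) ^ 2 := by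
    have h3 : (x - y) * (θ - θ') = 7 * (m1 - m3) := by linear_combination e1 - e3
    have h4 : (θ - θ') ^ 2 = -7 := by linear_combination (θ + θ' - 1) * h1 - 4 * h2
    have h5 : (x - y)^2 * (θ - θ')^2 = 49 * (m1 - m3)^2 := by rw [← mul_pow, h3]; ring
    rw [h4] at h5
    linear_combination (-1/7) * h5
  have h6 : m0 + 3 * (m1 + m3) = 6 := by
    have : ((m0 + 3 * (m1 + m3) : ℕ) : ℂ) = (6 : ℕ) := by
      push_cast
      linear_combination (-1/7) * e0 + (3/7) * hs
    exact_mod_cast this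
  have hle1 : m1 ≤ 2 := by omega
  have hle3 : m3 ≤ 2 := by omega
  have hxy : 4 * (x * y) = (x + y)^2 - (x-y)^2 := by ring
  rw [hs, hd] at hxy
  interval_cases m1 <;> interval_cases m3 <;> first | omega | skip
  · right; linear_combination (1/4) * hxy
  · right; norm_num at hxy; linear_combination (1/4) * hxy
  · right; linear_combination (1/4) * hxy
  · left
    have : x - y = 0 := by
      rw [← sq_eq_zero_iff, hd]; norm_num
    norm_num at hs
    constructor
    · linear_combination (1/2) * this + (1/2) * hs
    · linear_combination (-1/2) * this + (1/2) * hs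
  · right; norm_num at hxy; linear_combination (1/4) * hxy


theorem theta_exists : ∃ ζ : ℂ, ζ ^ 7 = 1 ∧ 1 + ζ + ζ^2 + ζ^3 + ζ^4 + ζ^5 + ζ^6 = 0 := by
  have h := Complex.isPrimitiveRoot_exp 7 (by norm_num)
  refine ⟨_, h.pow_eq_one, ?_⟩
  have := h.geom_sum_eq_zero (by norm_num)
  simpa [Finset.sum_range_succ] using this

theorem five_exists : ∃ ζ : ℂ, ζ ^ 5 = 1 ∧ 1 + ζ + ζ^2 + ζ^3 + ζ^4 = 0 := by
  have h := Complex.isPrimitiveRoot_exp 5 (by norm_num)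
  refine ⟨_, h.pow_eq_one, ?_⟩
  have := h.geom_sum_eq_zero (by norm_num)
  simpa [Finset.sum_range_succ] using this

theorem three_exists : ∃ ζ : ℂ, ζ ^ 3 = 1 ∧ 1 + ζ + ζ^2 = 0 := by
  have h := Complex.isPrimitiveRoot_exp 3 (by norm_num)
  refine ⟨_, h.pow_eq_one, ?_⟩
  have := h.geom_sum_eq_zero (by norm_num)
  simpa [Finset.sum_range_succ] using this

theorem char_pow_sum {g : G} (n : ℕ) (hn : n ≠ 0) (hg : g ^ n = 1) (ζ : ℂ) (hz : ζ ^ n = 1) :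
    ∃ m : ℕ, ∑ k ∈ Finset.range n, ζ ^ k * ρ.character (g ^ k) = n * m := by
  obtain ⟨m, hm⟩ := mult_z (ρ g) ζ n hn (by rw [← map_pow, hg, map_one]) hz
  refine ⟨m, ?_⟩
  rw [← hm]
  simp only [character, map_pow]

theorem char_pow_sum1 {g : G} (n : ℕ) (hn : n ≠ 0) (hg : g ^ n = 1) :
    ∃ m : ℕ, ∑ k ∈ Finset.range n, ρ.character (g ^ k) = n * m ∧ (m = Module.finrank ℂ U → ρ g = 1) := by
  obtain ⟨m, hm, h⟩ := mult (ρ g) n hn (by rw [← map_pow, hg, map_one])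
  refine ⟨m, ?_, h⟩
  rw [← hm]
  simp only [character, map_pow]

theorem three_val (hdim : Module.finrank ℂ U = 6) {g : G} (hg : g ^ 3 = 1) (hi : IsConj g g⁻¹) :
    ∃ m : ℤ, ρ.character g = ((6 - 3 * m : ℤ) : ℂ) := by
  obtain ⟨ζ, hz, hz1⟩ := three_exists
  obtain ⟨m, hm⟩ := char_pow_sum (ρ := ρ) 3 (by norm_num) hg ζ hz
  refine ⟨m, ?_⟩
  have e2 : ρ.character (g ^ 2) = ρ.character g := by
    rw [char_isConj ρ hi, inv_eq_of_mul_eq_one_right (show g * g ^ 2 = 1 by rw [← pow_succ']; exact hg)]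
  simp only [Finset.sum_range_succ, Finset.sum_range_zero, pow_zero, pow_one, char_one, e2, hdim] at hm
  push_cast at hm ⊢
  linear_combination ρ.character g * hz1 - hm

theorem two_val (hdim : Module.finrank ℂ U = 6) {g : G} (hg : g ^ 2 = 1) :
    ∃ m : ℤ, ρ.character g = ((6 - 2 * m : ℤ) : ℂ) := by
  obtain ⟨m, hm⟩ := char_pow_sum (ρ := ρ) 2 (by norm_num) hg (-1) (by norm_num)
  refine ⟨m, ?_⟩
  simp only [Finset.sum_range_succ, Finset.sum_range_zero, pow_zero, pow_one, char_one, hdim] at hm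
  push_cast at hm ⊢
  linear_combination -hm

theorem v4_val (S : Sys π) (hdim : Module.finrank ℂ U = 6) :
    ∃ m : ℤ, 3 * ρ.character S.g2 + 6 = ((4 * m : ℤ) : ℂ) := by
  obtain ⟨m, hm⟩ := mult_v4 (ρ S.g2) (ρ S.s) (by rw [← map_pow, S.o2, map_one])
    (by rw [← map_pow, S.os, map_one]) (by rw [← map_mul, ← map_mul, S.cs])
  refine ⟨m, ?_⟩
  rw [← map_mul] at hm
  change _ + ρ.character S.g2 + ρ.character S.s + ρ.character (S.g2 * S.s) = _ at hm
  rw [← char_isConj ρ S.is, ← char_isConj ρ S.i2s, hdim] at hm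
  push_cast at hm ⊢
  linear_combination hm

theorem four_val (S : Sys π) (hdim : Module.finrank ℂ U = 6) :
    ∃ m d : ℤ, ρ.character S.g42 = d ∧ 6 + 2 * ρ.character S.g42 + ρ.character S.g2 = ((4 * m : ℤ) : ℂ) := by
  obtain ⟨m, hm⟩ := char_pow_sum (ρ := ρ) 4 (by norm_num) S.o42 1 (by norm_num)
  obtain ⟨m', hm'⟩ := char_pow_sum (ρ := ρ) 4 (by norm_num) S.o42 (-1) (by norm_num)
  have e3 : ρ.character (S.g42 ^ 3) = ρ.character S.g42 := by
    rw [char_isConj ρ S.i42, inv_eq_of_mul_eq_one_right (show S.g42 * S.g42 ^ 3 = 1 by rw [← pow_succ']; exact S.o42)]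
  simp only [Finset.sum_range_succ, Finset.sum_range_zero, pow_zero, pow_one, char_one, e3, hdim, ← char_isConj ρ S.q42] at hm hm'
  refine ⟨m, m - m', ?_, ?_⟩
  · push_cast at hm hm' ⊢
    linear_combination (1/4) * hm - (1/4) * hm'
  · push_cast at hm hm' ⊢
    linear_combination hm

theorem six_val (S : Sys π) (hdim : Module.finrank ℂ U = 6) (a b : ℤ) (ha : ρ.character S.g2 = a)
    (hb : ρ.character S.g3 = b) (ha2 : ∃ p, a = 6 - 2 * p) (hb3 : ∃ p, b = 6 - 3 * p) :
    ∃ f : ℤ, ρ.character S.g6 = f := by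
  obtain ⟨m, hm⟩ := char_pow_sum (ρ := ρ) 6 (by norm_num) S.o6 1 (by norm_num)
  obtain ⟨m', hm'⟩ := char_pow_sum (ρ := ρ) 6 (by norm_num) S.o6 (-1) (by norm_num)
  have e5 : ρ.character (S.g6 ^ 5) = ρ.character S.g6 := by
    rw [char_isConj ρ S.i6, inv_eq_of_mul_eq_one_right (show S.g6 * S.g6 ^ 5 = 1 by rw [← pow_succ']; exact S.o6)]
  have e4 : ρ.character (S.g6 ^ 4) = b := by
    rw [← hb, char_isConj ρ S.i3, inv_eq_of_mul_eq_one_right (show S.g3 * S.g6 ^ 4 = 1 by rw [← S.q6, ← pow_add]; exact S.o6)]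
  simp only [Finset.sum_range_succ, Finset.sum_range_zero, pow_zero, pow_one, char_one, e5, e4, hdim, S.q6, S.t6, ha, hb] at hm hm'
  obtain ⟨p, hp⟩ := ha2
  obtain ⟨q, hq⟩ := hb3
  have h1 : 12 + 4 * b = 6 * (m + m' : ℤ) := by
    have : ((12 + 4 * b : ℤ) : ℂ) = (6 * (m + m' : ℤ) : ℤ) := by
      push_cast at hm hm' ⊢
      linear_combination hm + hm'
    exact_mod_cast this
  obtain ⟨f, hf⟩ : ∃ f : ℤ, 2 * f = 3 * (m - m' : ℤ) - a := ⟨(3 * (m - m' : ℤ) - a) / 2, by omega⟩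
  refine ⟨f, ?_⟩
  have hf' : 2 * (f : ℂ) = 3 * (m - m') - a := by exact_mod_cast hf
  push_cast at hm hm'
  linear_combination (1/4) * hm - (1/4) * hm' - (1/2) * hf'

theorem five_val (C : Cov π) (S : Sys π) (hdim : Module.finrank ℂ U = 6) (hirr : Irr ρ) :
    ρ.character S.g5 = 1 := by
  obtain ⟨ζ, hz, hz1⟩ := five_exists
  obtain ⟨m, hm⟩ := char_pow_sum (ρ := ρ) 5 (by norm_num) S.o5 ζ hz
  obtain ⟨m0, hm0, hne⟩ := char_pow_sum1 (ρ := ρ) 5 (by norm_num) S.o5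
  have e2 := char_isConj ρ S.q5
  have e4 : ρ.character S.g5 = ρ.character (S.g5 ^ 4) := by
    rw [char_isConj ρ S.isConj_inv.2.2.2.2.1, inv_eq_of_mul_eq_one_right (show S.g5 * S.g5 ^ 4 = 1 by rw [← pow_succ']; exact S.o5)]
  have e3 : ρ.character (S.g5 ^ 2) = ρ.character (S.g5 ^ 3) := by
    have h5 : IsConj (S.g5 ^ 2) (S.g5 ^ 2)⁻¹ := by
      obtain ⟨x, hx⟩ := isConj_iff.1 S.isConj_inv.2.2.2.2.1
      exact isConj_iff.2 ⟨x, by rw [← conj_pow, hx, inv_pow]⟩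
    rw [char_isConj ρ h5, inv_eq_of_mul_eq_one_right (show S.g5 ^ 2 * S.g5 ^ 3 = 1 by rw [← pow_add]; exact S.o5)]
  simp only [Finset.sum_range_succ, Finset.sum_range_zero, pow_zero, pow_one, char_one, ← e3, ← e4, ← e2, hdim] at hm hm0
  push_cast at hm hm0
  have h1 : ρ.character S.g5 = 6 - 5 * m := by linear_combination ρ.character S.g5 * hz1 - hm
  have h2 : m0 + 4 * m = 6 := by
    have : ((m0 + 4 * m : ℕ) : ℂ) = (6 : ℕ) := by
      push_cast
      linear_combination (-1/5) * hm0 + (4/5) * h1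
    exact_mod_cast this
  have h3 : m0 ≠ 6 := by
    intro h
    have := C.ker_le (by omega) hirr (hne (by omega))
    have h5 := S.c5
    rw [this] at h5
    revert h5; decide
  have : m = 1 := by omega
  rw [h1, this]; norm_num

theorem seven_val (C : Cov π) (S : Sys π) (hdim : Module.finrank ℂ U = 6) (hirr : Irr ρ) :
    (ρ.character S.g7 = -1 ∧ ρ.character S.g7⁻¹ = -1) ∨ ρ.character S.g7 * ρ.character S.g7⁻¹ = 8 := by
  obtain ⟨ζ, hz, hz1⟩ := theta_exists
  obtain ⟨m1, hm1⟩ := char_pow_sum (ρ := ρ) 7 (by norm_num) S.o7 ζ hz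
  obtain ⟨m3, hm3⟩ := char_pow_sum (ρ := ρ) 7 (by norm_num) S.o7 (ζ ^ 3) (by rw [← pow_mul, mul_comm, pow_mul, hz, one_pow])
  obtain ⟨m0, hm0, hne⟩ := char_pow_sum1 (ρ := ρ) 7 (by norm_num) S.o7
  have hc : ∀ k, ρ.character (S.g7 ^ (2 * k)) = ρ.character (S.g7 ^ k) := by
    intro k
    obtain ⟨x, hx⟩ := isConj_iff.1 S.q7
    rw [pow_mul, ← hx, conj_pow, char_conj]
  have e2 := hc 1
  have e4 := hc 2
  have e6 := hc 3
  have e3 := hc 5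
  have e5 := hc 6
  norm_num at e2 e4 e6 e3 e5
  rw [show S.g7 ^ 10 = S.g7 ^ 3 by rw [show 10 = 7 + 3 from rfl, pow_add, S.o7, one_mul]] at e3
  rw [show S.g7 ^ 12 = S.g7 ^ 5 by rw [show 12 = 7 + 5 from rfl, pow_add, S.o7, one_mul]] at e5
  have ei : S.g7⁻¹ = S.g7 ^ 6 := inv_eq_of_mul_eq_one_right (by rw [← pow_succ']; exact S.o7)
  rw [ei]
  simp only [Finset.sum_range_succ, Finset.sum_range_zero, pow_zero, pow_one, char_one, hdim,
    e4, e2, e3, e5] at hm1 hm3 hm0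
  push_cast at hm1 hm3 hm0
  refine sev_aux _ _ m0 m1 m3 (ζ + ζ^2 + ζ^4) (ζ^3 + ζ^5 + ζ^6) ?_ ?_ ?_ ?_ ?_ ?_
  · linear_combination hz1
  · linear_combination hz1 + (3 + ζ + ζ^2 + ζ^3) * hz
  · linear_combination hm0
  · linear_combination hm1
  · linear_combination hm3 - ρ.character S.g7 * ζ^5 * hz - ρ.character (S.g7 ^ 6) * (ζ^2 + (ζ + ζ^4) * (1 + ζ^7)) * hz
  · intro h
    have := C.ker_le (by omega) hirr (hne (by omega))
    rw [S.c7] at this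
    revert this; decide

end Main
end TA7

namespace TA7
set_option linter.unusedSectionVars false
open Representation
section Main
variable {G : Type} [Group G] {π : G →* A7}
variable {U : Type} [AddCommGroup U] [Module ℂ U] [FiniteDimensional ℂ U] {ρ : Representation ℂ G U}

@[reducible]
noncomputable def invCard (G : Type) [Group G] [Finite G] : Invertible (Nat.card G : ℂ) :=
  invertibleOfNonzero (by exact_mod_cast Nat.card_pos.ne')

theorem nontriv (hdim : Module.finrank ℂ U = 6) : Nontrivial U :=
  (Module.finrank_pos_iff (R := ℂ)).1 (by omega)

abbrev X3 (U : Type) [AddCommGroup U] [Module ℂ U] := U →ₗ[ℂ] U →ₗ[ℂ] U →ₗ[ℂ] ℂ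

/-- trilinear forms -/
noncomputable def tri (ρ : Representation ℂ G U) : Representation ℂ G (X3 U) :=
  linHom ρ (linHom ρ ρ.dual)

theorem tri_apply (g : G) (T : U →ₗ[ℂ] U →ₗ[ℂ] U →ₗ[ℂ] ℂ) (u v w : U) :
    tri ρ g T u v w = T (ρ g⁻¹ u) (ρ g⁻¹ v) (ρ g⁻¹ w) := rfl

theorem tri_char (g : G) : character (V := X3 U) (tri ρ) g = ρ.character g⁻¹ ^ 3 := by
  have h1 := char_linHom (W := U →ₗ[ℂ] Module.Dual ℂ U) ρ (linHom ρ ρ.dual) g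
  have h2 := char_linHom (W := Module.Dual ℂ U) ρ ρ.dual g
  rw [char_dual] at h2
  rw [h2] at h1
  refine h1.trans ?_
  ring

theorem inv_vals (S : Sys π) : ρ.character S.g2⁻¹ = ρ.character S.g2 ∧ ρ.character S.g3⁻¹ = ρ.character S.g3 ∧
    ρ.character S.g33⁻¹ = ρ.character S.g33 ∧ ρ.character S.g42⁻¹ = ρ.character S.g42 ∧
    ρ.character S.g5⁻¹ = ρ.character S.g5 ∧ ρ.character S.g6⁻¹ = ρ.character S.g6 := by
  obtain ⟨h1, h2, h3, h4, h5, h6⟩ := S.isConj_inv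
  exact ⟨(char_isConj ρ h1).symm, (char_isConj ρ h2).symm, (char_isConj ρ h3).symm,
    (char_isConj ρ h4).symm, (char_isConj ρ h5).symm, (char_isConj ρ h6).symm⟩

theorem inv_conj (g h : G) : (h * g * h⁻¹)⁻¹ = h * g⁻¹ * h⁻¹ := by group

theorem norm_eq [Fintype G] (C : Cov π) (S : Sys π) (hdim : Module.finrank ℂ U = 6) (hirr : Irr ρ) :
    36 + 105 * ρ.character S.g2 ^ 2 + 70 * ρ.character S.g3 ^ 2 + 280 * ρ.character S.g33 ^ 2
    + 630 * ρ.character S.g42 ^ 2 + 504 * ρ.character S.g5 ^ 2 + 210 * ρ.character S.g6 ^ 2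
    + 720 * (ρ.character S.g7 * ρ.character S.g7⁻¹) = 2520 := by
  have := nontriv hdim
  have := invCard G
  have := hirr.inst
  have h1 := card_inv_mul_sum_char_mul_char_eq_finrank ρ ρ
  rw [IsIrreducible.finrank_intertwiningMap_self] at h1
  obtain ⟨i2, i3, i33, i42, i5, i6⟩ := inv_vals (ρ := ρ) S
  rw [C.avg S] at h1
  · simp only [char_one, i2, i3, i33, i42, i5, i6, hdim, inv_one] at h1
    push_cast at h1
    rw [div_eq_iff (by norm_num)] at h1
    linear_combination h1
  · intro g h
    rw [inv_conj, char_conj, char_conj]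
  · intro g z hz
    obtain ⟨c, hc, h⟩ := C.char_cen hirr hz
    have hc0 : c ≠ 0 := by rintro rfl; norm_num at hc
    unfold character
    rw [(h g).1, (h g).2, map_smul, map_smul, smul_eq_mul, smul_eq_mul]
    field_simp
  · rw [inv_inv, mul_comm]

theorem cube_eq [Fintype G] (C : Cov π) (S : Sys π) (hdim : Module.finrank ℂ U = 6) (hirr : Irr ρ)
    (h7 : ρ.character S.g7⁻¹ = ρ.character S.g7) :
    216 + 105 * ρ.character S.g2 ^ 3 + 70 * ρ.character S.g3 ^ 3 + 280 * ρ.character S.g33 ^ 3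
    + 630 * ρ.character S.g42 ^ 3 + 504 * ρ.character S.g5 ^ 3 + 210 * ρ.character S.g6 ^ 3
    + 720 * ρ.character S.g7 ^ 3 = 2520 * Module.finrank ℂ (invariants (V := X3 U) (tri ρ)) := by
  have := nontriv hdim
  have := invCard G
  have h1 := card_inv_mul_sum_char_eq_finrank (V := X3 U) (tri ρ)
  obtain ⟨i2, i3, i33, i42, i5, i6⟩ := inv_vals (ρ := ρ) S
  rw [C.avg S] at h1
  · simp only [tri_char] at h1
    simp only [inv_one, char_one, i2, i3, i33, i42, i5, i6, h7, hdim] at h1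
    push_cast at h1
    rw [div_eq_iff (by norm_num)] at h1
    linear_combination h1
  · intro g h
    rw [char_conj]
  · intro g z hz
    obtain ⟨c, hc, h⟩ := C.char_cen hirr hz
    rw [tri_char, tri_char]
    unfold character
    rw [(h g).2, map_smul, smul_eq_mul, mul_pow, inv_pow, hc]
    simp
  · rw [tri_char, tri_char, inv_inv, h7]

theorem vals [Fintype G] (C : Cov π) (S : Sys π) (hdim : Module.finrank ℂ U = 6) (hirr : Irr ρ) :
    ρ.character S.g2 = 2 ∧ ρ.character S.g33 = 0 ∧ ρ.character S.g42 = 0 ∧ ρ.character S.g5 = 1 ∧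
    ρ.character S.g7 = -1 ∧ ρ.character S.g7⁻¹ = -1 ∧ Module.finrank ℂ (invariants (V := X3 U) (tri ρ)) = 1 ∧
    ((ρ.character S.g3 = 3 ∧ ρ.character S.g6 = -1) ∨ (ρ.character S.g3 = 0 ∧ ρ.character S.g6 = 2)) := by
  obtain ⟨p2, ha⟩ := two_val (ρ := ρ) hdim S.o2
  obtain ⟨p4, hv⟩ := v4_val (ρ := ρ) S hdim
  obtain ⟨p3, hb⟩ := three_val (ρ := ρ) hdim S.o3 S.i3
  obtain ⟨p33, hc⟩ := three_val (ρ := ρ) hdim S.o33 S.i33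
  obtain ⟨q, d, hd, hq⟩ := four_val (ρ := ρ) S hdim
  obtain ⟨f, hf⟩ := six_val (ρ := ρ) S hdim _ _ ha hb ⟨_, rfl⟩ ⟨_, rfl⟩
  have he := five_val C S hdim hirr
  have hn := norm_eq C S hdim hirr
  rw [ha] at hv
  rw [ha, hd] at hq
  rw [ha, hb, hc, hd, he, hf] at hn
  have h77 : ρ.character S.g7 = -1 ∧ ρ.character S.g7⁻¹ = -1 := by
    rcases seven_val C S hdim hirr with h | h
    · exact h
    · exfalso
      rw [h] at hn
      norm_cast at hn
      norm_num at hn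
      nlinarith [sq_nonneg (6 - 2 * p2), sq_nonneg (6 - 3 * p3), sq_nonneg (6 - 3 * p33), sq_nonneg d, sq_nonneg f]
  have h3 := cube_eq C S hdim hirr (by rw [h77.1, h77.2])
  rw [ha, hb, hc, hd, he, hf, h77.1] at h3
  rw [h77.1, h77.2] at hn
  have hn' : 36 + 105*(6 - 2 * p2)^2 + 70*(6 - 3 * p3)^2+280*(6 - 3 * p33)^2+630*d^2+504+210*f^2+720 = 2520 := by
    have := hn
    norm_num at this
    exact_mod_cast this
  have h3' : 216 + 105*(6 - 2 * p2)^3 + 70*(6 - 3 * p3)^3+280*(6 - 3 * p33)^3+630*d^3+504+210*f^3-720 =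
      2520*(Module.finrank ℂ (invariants (V := X3 U) (tri ρ)) : ℤ) := by
    have : (216 : ℂ) + 105*(6 - 2 * p2)^3 + 70*(6 - 3 * p3)^3+280*(6 - 3 * p33)^3+630*d^3+504+210*f^3-720 =
      2520*(Module.finrank ℂ (invariants (V := X3 U) (tri ρ)) : ℂ) := by
      rw [← h3]; push_cast; ring
    exact_mod_cast this
  have key := num_aux (6 - 2 * p2) (6 - 3 * p3) (6 - 3 * p33) d f p2 p4 p3 q _ rfl (by exact_mod_cast hv) rfl ⟨_, rfl⟩
    (by exact_mod_cast hq) hn' h3'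
  obtain ⟨k1, k2, k3, k4⟩ := key
  rw [k1, k2, k3] at h3'
  have hm : Module.finrank ℂ (invariants (V := X3 U) (tri ρ)) = 1 := by
    rcases k4 with ⟨k4, k5⟩ | ⟨k4, k5⟩ <;> rw [k4, k5] at h3' <;> norm_num at h3' <;> omega
  refine ⟨by rw [ha, k1]; norm_num, by rw [hc, k2]; norm_num, by rw [hd, k3]; norm_num, he, h77.1, h77.2, hm, ?_⟩
  rw [hb, hf]
  rcases k4 with ⟨k4, k5⟩ | ⟨k4, k5⟩
  · left; rw [k4, k5]; norm_num
  · right; rw [k4, k5]; norm_num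

end Main
end TA7

namespace TA7
open Representation
section Main
variable {G : Type} [Group G] {π : G →* A7}
variable {U : Type} [AddCommGroup U] [Module ℂ U] [FiniteDimensional ℂ U] {ρ : Representation ℂ G U}

theorem faith_val (C : Cov π) (S : Sys π) (hdim : Module.finrank ℂ U = 6) (hirr : Irr ρ)
    (hz : ∃ z ∈ Subgroup.center G, z ≠ 1) (hinj : Function.Injective ρ) : ρ.character S.g3 = 0 := by
  have := nontriv hdim
  obtain ⟨P, hP⟩ := C.surj r3
  obtain ⟨Q, hQ⟩ := C.surj r3'
  have hne := C.not_comm hz hP hQ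
  have e : π (Q * P * Q⁻¹) = π P := by
    rw [map_mul, map_mul, map_inv, hP, hQ]
    decide
  obtain ⟨z, hz, ez⟩ := C.eq_mul e
  have hz1 : z ≠ 1 := by
    rintro rfl
    apply hne
    rw [mul_one] at ez
    rw [mul_inv_eq_iff_eq_mul] at ez
    exact ez.symm
  obtain ⟨c, hc, h⟩ := C.char_cen hirr hz
  have hc1 : c ≠ 1 := by
    rintro rfl
    apply hz1
    apply hinj
    have := (h 1).1
    rw [one_mul, one_smul] at this
    exact this
  have hcp : ρ.character P = 0 := by
    have h1 := char_conj ρ P Q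
    rw [ez] at h1
    unfold character at h1 ⊢
    rw [(h P).1, map_smul, smul_eq_mul] at h1
    have : (c - 1) * LinearMap.trace ℂ U (ρ P) = 0 := by linear_combination h1
    exact (mul_eq_zero.1 this).resolve_left (sub_ne_zero.2 hc1)
  obtain ⟨k, hk⟩ := conj3 _ S.c3
  obtain ⟨x, rfl⟩ := C.surj k
  rw [← hP] at hk
  have e2 : π S.g3 = π (x * P * x⁻¹) := by rw [← hk]; simp
  obtain ⟨w, hw, ew⟩ := C.eq_mul e2
  obtain ⟨d, -, hd⟩ := C.char_cen hirr hw
  rw [ew]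
  have h3 := char_conj ρ P x
  rw [hcp] at h3
  unfold character at h3 ⊢
  rw [(hd _).1, map_smul, h3, smul_zero]

theorem nonfaith_cen (C : Cov π) (hdim : Module.finrank ℂ U = 6) (hirr : Irr ρ)
    (h3 : Nat.card (Subgroup.center G) = 3) (hinj : ¬ Function.Injective ρ) :
    (∃ k ∈ Subgroup.center G, k ≠ 1 ∧ ρ k = 1) ∧ ∀ z ∈ Subgroup.center G, ρ z = 1 := by
  obtain ⟨g, h, e, hne⟩ : ∃ g h, ρ g = ρ h ∧ g ≠ h := by
    simpa [Function.Injective] using hinj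
  have hk : ρ (g⁻¹ * h) = 1 := by rw [map_mul, ← e, ← map_mul, inv_mul_cancel, map_one]
  have hk1 : g⁻¹ * h ≠ 1 := fun h' => hne (inv_mul_eq_one.1 h')
  have hkc : g⁻¹ * h ∈ Subgroup.center G := (C.ker _).1 (C.ker_le (by omega) hirr hk)
  generalize g⁻¹ * h = k at hk hk1 hkc
  refine ⟨⟨k, hkc, hk1, hk⟩, fun z hz => ?_⟩
  have : Fact (Nat.Prime 3) := ⟨by norm_num⟩
  have h4 : (⟨z, hz⟩ : Subgroup.center G) ∈ Subgroup.zpowers (⟨k, hkc⟩ : Subgroup.center G) :=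
    mem_zpowers_of_prime_card h3 (by intro h; exact hk1 (congrArg Subtype.val h))
  have h5 : ∃ n : ℕ, z = k ^ n := by
    have : Finite (Subgroup.center G) := Nat.finite_of_card_ne_zero (by omega)
    rw [← mem_powers_iff_mem_zpowers] at h4
    obtain ⟨n, hn⟩ := h4
    exact ⟨n, (congrArg Subtype.val hn).symm⟩
  obtain ⟨n, rfl⟩ := h5
  rw [map_pow, hk, one_pow]

theorem nonfaith_val [Fintype G] (C : Cov π) (S : Sys π) (hdim : Module.finrank ℂ U = 6) (hirr : Irr ρ)
    (hz : ∀ z ∈ Subgroup.center G, ρ z = 1) : ρ.character S.g3 = 3 ∧ ρ.character S.g6 = -1 := by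
  obtain ⟨h2, h33, h42, h5, h7, h7', -, h⟩ := vals C S hdim hirr
  rcases h with h | ⟨h3, h6⟩
  · exact h
  exfalso
  have := invCard G
  have h1 := card_inv_mul_sum_char_eq_finrank ρ
  have h0 : Module.finrank ℂ (invariants ρ) = 0 := by
    rcases hirr (invariants ρ) (fun g v hv => by rw [hv g]; exact hv) with h | h
    · rw [h, finrank_bot]
    · exfalso
      have hg : ρ S.g7 = 1 := by
        ext v
        have : v ∈ invariants ρ := h ▸ Submodule.mem_top
        exact this _
      have := C.ker_le (by omega) hirr hg
      rw [S.c7] at this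
      revert this; decide
  rw [C.avg S] at h1
  · rw [char_one, h2, h33, h42, h5, h7, h3, h6, h0, hdim] at h1
    norm_num at h1
  · intro g h
    rw [char_conj]
  · intro g z hz'
    unfold character
    rw [map_mul, hz z hz', mul_one]
  · rw [h7, h7']

end Main
end TA7

namespace TA7
open Representation
set_option linter.unusedSectionVars false
section Forms
variable {U : Type} [AddCommGroup U] [Module ℂ U] [FiniteDimensional ℂ U]

abbrev X2 (U : Type) [AddCommGroup U] [Module ℂ U] := U →ₗ[ℂ] U →ₗ[ℂ] ℂ

noncomputable def q2 (U : Type) [AddCommGroup U] [Module ℂ U] : X2 U →ₗ[ℂ] (U → ℂ) where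
  toFun B := fun u => B u u
  map_add' _ _ := rfl
  map_smul' _ _ := rfl

noncomputable def q3 (U : Type) [AddCommGroup U] [Module ℂ U] : X3 U →ₗ[ℂ] (U → ℂ) where
  toFun B := fun u => B u u u
  map_add' _ _ := rfl
  map_smul' _ _ := rfl

theorem q2_mem (B : X2 U) : q2 U B ∈ symFormSpace U 2 := by
  let b := Module.finBasis ℂ U
  have : q2 U B = ∑ j, ∑ i, B (b i) (b j) • (fun u => ∏ k, (![b.coord i, b.coord j] k) u) := by
    ext u
    change B u u = _
    conv_lhs => rw [← b.sum_repr u]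
    simp only [map_sum, map_smul, LinearMap.sum_apply, LinearMap.smul_apply, Finset.sum_apply,
      Pi.smul_apply, Fin.prod_univ_two, smul_eq_mul, Finset.mul_sum]
    refine Finset.sum_congr rfl (fun i _ => Finset.sum_congr rfl (fun j _ => ?_))
    simp
    ring
  rw [this]
  refine Submodule.sum_mem _ (fun i _ => Submodule.sum_mem _ (fun j _ => Submodule.smul_mem _ _ ?_))
  exact Submodule.subset_span ⟨_, rfl⟩

theorem q2_range : LinearMap.range (q2 U) = symFormSpace U 2 := by
  apply le_antisymm
  · rintro _ ⟨B, rfl⟩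
    exact q2_mem B
  · refine Submodule.span_le.2 ?_
    rintro _ ⟨φ, rfl⟩
    refine ⟨(φ 0).smulRight (φ 1), ?_⟩
    ext u
    simp [q2]

theorem q3_mem (B : X3 U) : q3 U B ∈ symFormSpace U 3 := by
  let b := Module.finBasis ℂ U
  have : q3 U B = ∑ l, ∑ j, ∑ i, B (b i) (b j) (b l) • (fun u => ∏ k, (![b.coord i, b.coord j, b.coord l] k) u) := by
    ext u
    change B u u u = _
    conv_lhs => rw [← b.sum_repr u]
    simp only [map_sum, map_smul, LinearMap.sum_apply, LinearMap.smul_apply, Finset.sum_apply,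
      Pi.smul_apply, Fin.prod_univ_three, smul_eq_mul, Finset.mul_sum]
    refine Finset.sum_congr rfl (fun i _ => Finset.sum_congr rfl (fun j _ => Finset.sum_congr rfl (fun l _ => ?_)))
    simp
    ring
  rw [this]
  refine Submodule.sum_mem _ (fun i _ => Submodule.sum_mem _ (fun j _ => Submodule.sum_mem _ (fun l _ => Submodule.smul_mem _ _ ?_)))
  exact Submodule.subset_span ⟨_, rfl⟩

theorem q3_range : LinearMap.range (q3 U) = symFormSpace U 3 := by
  apply le_antisymm
  · rintro _ ⟨B, rfl⟩
    exact q3_mem B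
  · refine Submodule.span_le.2 ?_
    rintro _ ⟨φ, rfl⟩
    refine ⟨(φ 0).smulRight ((φ 1).smulRight (φ 2)), ?_⟩
    ext u
    simp [q3, Fin.prod_univ_three, mul_assoc]

noncomputable def fl (U : Type) [AddCommGroup U] [Module ℂ U] : X2 U →ₗ[ℂ] X2 U where
  toFun B := B.flip
  map_add' _ _ := rfl
  map_smul' _ _ := rfl

/-- symmetrization -/
noncomputable def sy (U : Type) [AddCommGroup U] [Module ℂ U] : X2 U →ₗ[ℂ] X2 U :=
  (1/2 : ℂ) • (LinearMap.id + fl U)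

theorem sy_apply (B : X2 U) (u v : U) : sy U B u v = (1/2) * (B u v + B v u) := rfl

theorem q2_sy (B : X2 U) : q2 U (sy U B) = q2 U B := by
  ext u
  change sy U B u u = B u u
  rw [sy_apply]; ring

theorem sy_zero (B : X2 U) (h : q2 U B = 0) : sy U B = 0 := by
  ext u v
  have h1 : ∀ w, B w w = 0 := fun w => congrFun h w
  have h2 := h1 (u + v)
  simp only [map_add, LinearMap.add_apply, h1] at h2
  rw [sy_apply]
  simp only [LinearMap.zero_apply]
  linear_combination (1/2) * h2

noncomputable def qV (U : Type) [AddCommGroup U] [Module ℂ U] [FiniteDimensional ℂ U] : X2 U →ₗ[ℂ] symFormSpace U 2 :=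
  (q2 U).codRestrict _ q2_mem

theorem exists_sec : ∃ s : symFormSpace U 2 →ₗ[ℂ] X2 U, qV U ∘ₗ s = LinearMap.id ∧ s ∘ₗ qV U = sy U := by
  have hsurj : LinearMap.range (qV U) = ⊤ := by
    rw [LinearMap.range_eq_top]
    rintro ⟨f, hf⟩
    rw [← q2_range] at hf
    obtain ⟨B, rfl⟩ := hf
    exact ⟨B, rfl⟩
  obtain ⟨s0, hs0⟩ := (qV U).exists_rightInverse_of_surjective hsurj
  have h0 : ∀ f, qV U (s0 f) = f := fun f => LinearMap.congr_fun hs0 f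
  refine ⟨sy U ∘ₗ s0, ?_, ?_⟩
  · ext1 f
    apply Subtype.ext
    change q2 U (sy U (s0 f)) = f
    rw [q2_sy]
    exact congrArg Subtype.val (h0 f)
  · ext1 B
    change sy U (s0 (qV U B)) = sy U B
    rw [← sub_eq_zero, ← map_sub]
    apply sy_zero
    rw [map_sub, sub_eq_zero]
    exact congrArg Subtype.val (h0 (qV U B))

instance : FiniteDimensional ℂ (symFormSpace U 2) := by
  rw [← q2_range]; infer_instance

theorem X2_trace (F : X2 U →ₗ[ℂ] X2 U) {ι : Type} [Fintype ι] [DecidableEq ι] (b : Module.Basis ι ℂ U) :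
    LinearMap.trace ℂ (X2 U) F = ∑ i, ∑ j, F ((b.coord i).smulRight (b.coord j)) (b i) (b j) := by
  let β : Module.Basis (ι × ι) ℂ (X2 U) := (Matrix.stdBasis ℂ ι ι).map (LinearMap.toMatrix₂ b b).symm
  have hβ : ∀ i j, β (i, j) = (b.coord i).smulRight (b.coord j) := by
    intro i j
    simp only [β, Module.Basis.map_apply, LinearEquiv.symm_apply_eq]
    ext k l
    simp [LinearMap.toMatrix₂_apply, Matrix.stdBasis_eq_single, Matrix.single, Finsupp.single_apply]
    by_cases h1 : k = i <;> by_cases h2 : l = j <;> simp [h1, h2] <;> grind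
  have hr : ∀ B p, β.repr B p = B (b p.1) (b p.2) := by
    intro B p
    simp [β, Module.Basis.map_repr, Matrix.stdBasis]
  rw [LinearMap.trace_eq_matrix_trace ℂ β, Matrix.trace, Fintype.sum_prod_type]
  refine Finset.sum_congr rfl (fun i _ => Finset.sum_congr rfl (fun j _ => ?_))
  rw [Matrix.diag_apply, LinearMap.toMatrix_apply, hr, hβ]

end Forms
end TA7

namespace TA7
open Representation
set_option linter.unusedSectionVars false
section Forms
variable {U : Type} [AddCommGroup U] [Module ℂ U] [FiniteDimensional ℂ U]

/-- pull back of bilinear forms -/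
noncomputable def xa (A : U →ₗ[ℂ] U) : X2 U →ₗ[ℂ] X2 U where
  toFun B := B.compl₁₂ A A
  map_add' _ _ := rfl
  map_smul' _ _ := rfl

theorem xa_apply (A : U →ₗ[ℂ] U) (B : X2 U) (u v : U) : xa A B u v = B (A u) (A v) := rfl

theorem q2_xa (A : U →ₗ[ℂ] U) (B : X2 U) : q2 U (xa A B) = fun u => q2 U B (A u) := rfl

theorem xa_sy_trace (A : U →ₗ[ℂ] U) : LinearMap.trace ℂ (X2 U) (xa A ∘ₗ sy U) =
    (1/2) * (LinearMap.trace ℂ U A ^ 2 + LinearMap.trace ℂ U (A * A)) := by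
  let b := Module.finBasis ℂ U
  rw [X2_trace _ b, LinearMap.trace_eq_matrix_trace ℂ b, LinearMap.trace_eq_matrix_trace ℂ b,
    LinearMap.toMatrix_mul, Matrix.trace, Matrix.trace, pow_two, Finset.sum_mul_sum, ← Finset.sum_add_distrib,
    Finset.mul_sum]
  refine Finset.sum_congr rfl (fun i _ => ?_)
  simp only [Matrix.diag_apply]
  rw [Matrix.mul_apply, ← Finset.sum_add_distrib, Finset.mul_sum]
  refine Finset.sum_congr rfl (fun j _ => ?_)
  rw [LinearMap.comp_apply, xa_apply, sy_apply]
  simp [LinearMap.toMatrix_apply]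

theorem sym2_stable (A : U →ₗ[ℂ] U) : ∀ f ∈ symFormSpace U 2, LinearMap.funLeft ℂ ℂ A f ∈ symFormSpace U 2 := by
  intro f hf
  rw [← q2_range] at hf ⊢
  obtain ⟨B, rfl⟩ := hf
  exact ⟨xa A B, rfl⟩

noncomputable def sA (A : U →ₗ[ℂ] U) : symFormSpace U 2 →ₗ[ℂ] symFormSpace U 2 :=
  (LinearMap.funLeft ℂ ℂ A).restrict (sym2_stable A)

theorem sA_apply (A : U →ₗ[ℂ] U) (f : symFormSpace U 2) (u : U) : (sA A f).1 u = f.1 (A u) := rfl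

theorem sA_trace (A : U →ₗ[ℂ] U) : LinearMap.trace ℂ (symFormSpace U 2) (sA A) =
    (1/2) * (LinearMap.trace ℂ U A ^ 2 + LinearMap.trace ℂ U (A * A)) := by
  obtain ⟨s, h1, h2⟩ := exists_sec (U := U)
  rw [← xa_sy_trace, ← h2, ← LinearMap.comp_assoc, LinearMap.trace_comp_comm', ← LinearMap.comp_assoc]
  congr 1
  have : qV U ∘ₗ xa A = sA A ∘ₗ qV U := by ext B u; rfl
  rw [this, LinearMap.comp_assoc, h1, LinearMap.comp_id]

variable {G : Type} [Group G]

noncomputable def sq (ρ : Representation ℂ G U) : Representation ℂ G (symFormSpace U 2) where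
  toFun g := sA (ρ g⁻¹)
  map_one' := by ext f u; simp [sA_apply]
  map_mul' g h := by ext f u; simp [sA_apply]

theorem sq_apply (ρ : Representation ℂ G U) (g : G) (f : symFormSpace U 2) : (sq ρ g f).1 = formAct ρ g⁻¹ f.1 := rfl

theorem sq_char (ρ : Representation ℂ G U) (g : G) :
    (sq ρ).character g = (1/2) * (ρ.character g⁻¹ ^ 2 + ρ.character (g⁻¹ * g⁻¹)) := by
  unfold character
  rw [map_mul]
  exact sA_trace (ρ g⁻¹)

theorem sq_dim (hdim : Module.finrank ℂ U = 6) : Module.finrank ℂ (symFormSpace U 2) = 21 := by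
  have h := sA_trace (1 : U →ₗ[ℂ] U)
  have h1 : sA (1 : U →ₗ[ℂ] U) = 1 := by ext f u; simp [sA_apply]
  rw [h1, mul_one, LinearMap.trace_one, LinearMap.trace_one, hdim] at h
  norm_num at h
  exact_mod_cast h

theorem sq_cen (ρ : Representation ℂ G U) (z : G) (c : ℂ) (h : ρ z⁻¹ = c • 1) : sq ρ z = c ^ 2 • 1 := by
  obtain ⟨s, h1, h2⟩ := exists_sec (U := U)
  ext f u
  have h3 : f = qV U (s f) := (LinearMap.congr_fun h1 f).symm
  change f.1 (ρ z⁻¹ u) = c ^ 2 * f.1 u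
  rw [h, h3]
  change s f (c • u) (c • u) = c ^ 2 * s f u u
  simp only [map_smul, LinearMap.smul_apply, smul_eq_mul]
  ring
end Forms

section Main
variable {G : Type} [Group G] {π : G →* A7}
variable {U : Type} [AddCommGroup U] [Module ℂ U] [FiniteDimensional ℂ U] {ρ : Representation ℂ G U}

theorem sq_vals [Fintype G] (C : Cov π) (S : Sys π) (hdim : Module.finrank ℂ U = 6) (hirr : Irr ρ) :
    (sq ρ).character 1 = 21 ∧
    (sq ρ).character S.g2 = 5 ∧ (sq ρ).character S.g33 = 0 ∧ (sq ρ).character S.g42 = 1 ∧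
    (sq ρ).character S.g5 = 1 ∧ (sq ρ).character S.g7 = 0 ∧ (sq ρ).character S.g7⁻¹ = 0 ∧
    (sq ρ).character S.g3 = (1/2) * (ρ.character S.g3 ^ 2 + ρ.character S.g3) ∧
    (sq ρ).character S.g6 = (1/2) * (ρ.character S.g6 ^ 2 + ρ.character S.g3) := by
  obtain ⟨h2, h33, h42, h5, h7, h7', -, -⟩ := vals C S hdim hirr
  obtain ⟨i2, i3, i33, i42, i5, i6⟩ := inv_vals (ρ := ρ) S
  refine ⟨?_, ?_, ?_, ?_, ?_, ?_, ?_, ?_, ?_⟩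
  · rw [char_one, sq_dim hdim]; norm_num
  all_goals rw [sq_char]
  · rw [i2, h2, ← mul_inv_rev, ← pow_two, S.o2, inv_one, char_one, hdim]; norm_num
  · have : S.g33⁻¹ * S.g33⁻¹ = S.g33 := by
      have h := S.o33
      rw [← mul_inv_rev, ← pow_two]
      exact inv_eq_of_mul_eq_one_right (by rw [← pow_succ]; exact h)
    rw [this, i33, h33]; norm_num
  · have : ρ.character (S.g42⁻¹ * S.g42⁻¹) = 2 := by
      rw [← mul_inv_rev, ← pow_two, inv_eq_of_mul_eq_one_right (show S.g42 ^ 2 * S.g42 ^ 2 = 1 by rw [← pow_add]; exact S.o42),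
        ← char_isConj ρ S.q42, h2]
    rw [this, i42, h42]; norm_num
  · have : ρ.character (S.g5⁻¹ * S.g5⁻¹) = 1 := by
      have h : IsConj (S.g5⁻¹) (S.g5⁻¹ ^ 2) := by
        obtain ⟨x, hx⟩ := isConj_iff.1 S.q5
        exact isConj_iff.2 ⟨x, by rw [← inv_conj, hx, inv_pow]⟩
      rw [← pow_two, ← char_isConj ρ h, i5, h5]
    rw [this, i5, h5]; norm_num
  · have : ρ.character (S.g7⁻¹ * S.g7⁻¹) = -1 := by
      have h : IsConj (S.g7⁻¹) (S.g7⁻¹ ^ 2) := by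
        obtain ⟨x, hx⟩ := isConj_iff.1 S.q7
        exact isConj_iff.2 ⟨x, by rw [← inv_conj, hx, inv_pow]⟩
      rw [← pow_two, ← char_isConj ρ h, h7']
    rw [this, h7']; norm_num
  · rw [inv_inv, ← pow_two, ← char_isConj ρ S.q7, h7]; norm_num
  · have : S.g3⁻¹ * S.g3⁻¹ = S.g3 := by
      have h := S.o3
      rw [← mul_inv_rev, ← pow_two]
      exact inv_eq_of_mul_eq_one_right (by rw [← pow_succ]; exact h)
    rw [this, i3]
  · rw [← mul_inv_rev, ← pow_two, S.q6, i6, i3]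

end Main
end TA7

namespace TA7
open Representation
set_option linter.unusedSectionVars false
section Main
variable {G : Type} [Group G] {π : G →* A7}
variable {U : Type} [AddCommGroup U] [Module ℂ U] [FiniteDimensional ℂ U] {ρ : Representation ℂ G U}

theorem sq_char_cen (C : Cov π) [Nontrivial U] (hirr : Irr ρ) {z : G} (hz : z ∈ Subgroup.center G) :
    ∃ c : ℂ, c ^ 3 = 1 ∧ ∀ g, (sq ρ).character (g * z) = c⁻¹ ^ 2 * (sq ρ).character g ∧
      (sq ρ).character (g * z)⁻¹ = c ^ 2 * (sq ρ).character g⁻¹ ∧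
      ρ.character (g * z)⁻¹ = c⁻¹ * ρ.character g⁻¹ := by
  obtain ⟨c, h3, h⟩ := C.char_cen hirr hz
  refine ⟨c, h3, fun g => ⟨?_, ?_, ?_⟩⟩
  · rw [sq_char, sq_char]
    unfold character
    rw [map_mul ρ (g * z)⁻¹ (g * z)⁻¹, (h g).2, map_mul ρ g⁻¹ g⁻¹, smul_mul_smul_comm]
    simp only [map_smul, smul_eq_mul]
    ring
  · rw [sq_char, sq_char, inv_inv, inv_inv]
    unfold character
    rw [map_mul ρ (g * z) (g * z), (h g).1, map_mul ρ g g, smul_mul_smul_comm]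
    simp only [map_smul, smul_eq_mul]
    ring
  · unfold character
    rw [(h g).2, map_smul, smul_eq_mul]

theorem fin_U [Fintype G] (C : Cov π) (S : Sys π) (hdim : Module.finrank ℂ U = 6) (hirr : Irr ρ) :
    Module.finrank ℂ (IntertwiningMap ρ (sq ρ)) = 1 := by
  have := nontriv hdim
  have := invCard G
  have h1 := card_inv_mul_sum_char_mul_char_eq_finrank ρ (sq ρ)
  obtain ⟨h2, h33, h42, h5, h7, h7', -, hb⟩ := vals C S hdim hirr
  obtain ⟨i2, i3, i33, i42, i5, i6⟩ := inv_vals (ρ := ρ) S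
  obtain ⟨v1, v2, v33, v42, v5, v7, v7', v3, v6⟩ := sq_vals C S hdim hirr
  rw [C.avg S] at h1
  · rw [i2, i3, i33, i42, i5, i6, h7', v1, v2, v33, v42, v5, v7, v3, v6, h2, h33, h42, h5, inv_one, char_one, hdim] at h1
    have : ((Module.finrank ℂ (IntertwiningMap ρ (sq ρ)) : ℕ) : ℂ) = (1 : ℕ) := by
      rw [← h1]
      rcases hb with ⟨h3, h6⟩ | ⟨h3, h6⟩ <;> rw [h3, h6] <;> norm_num
    exact_mod_cast this
  · intro g h
    rw [inv_conj, char_conj, char_conj]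
  · intro g z hz
    obtain ⟨c, hc, h⟩ := sq_char_cen C hirr hz
    have hc' : c⁻¹ ^ 3 = 1 := by rw [inv_pow, hc, inv_one]
    rw [(h g).1, (h g).2.2]
    linear_combination (sq ρ).character g * ρ.character g⁻¹ * hc'
  · rw [v7, v7']; ring

theorem fin_V [Fintype G] (C : Cov π) (S : Sys π) (hdim : Module.finrank ℂ U = 6) (hirr : Irr ρ) :
    (ρ.character S.g3 = 0 → Module.finrank ℂ (IntertwiningMap (sq ρ) (sq ρ)) = 2) ∧ 
    (ρ.character S.g3 = 3 → Module.finrank ℂ (IntertwiningMap (sq ρ) (sq ρ)) = 3) := by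
  have := nontriv hdim
  have := invCard G
  have h1 := card_inv_mul_sum_char_mul_char_eq_finrank (sq ρ) (sq ρ)
  obtain ⟨h2, h33, h42, h5, h7, h7', -, hb⟩ := vals C S hdim hirr
  obtain ⟨i2, i3, i33, i42, i5, i6⟩ := inv_vals (ρ := sq ρ) S
  obtain ⟨v1, v2, v33, v42, v5, v7, v7', v3, v6⟩ := sq_vals C S hdim hirr
  rw [C.avg S] at h1
  · rw [i2, i3, i33, i42, i5, i6, inv_one, v1, v2, v33, v42, v5, v7, v3, v6] at h1
    constructor
    · intro h
      have : ((Module.finrank ℂ (IntertwiningMap (sq ρ) (sq ρ)) : ℕ) : ℂ) = (2 : ℕ) := by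
        rw [← h1]
        rcases hb with ⟨h3, h6⟩ | ⟨h3, h6⟩
        · rw [h3] at h; norm_num at h
        · rw [h3, h6]; norm_num
      exact_mod_cast this
    · intro h
      have : ((Module.finrank ℂ (IntertwiningMap (sq ρ) (sq ρ)) : ℕ) : ℂ) = (3 : ℕ) := by
        rw [← h1]
        rcases hb with ⟨h3, h6⟩ | ⟨h3, h6⟩
        · rw [h3, h6]; norm_num
        · rw [h3] at h; norm_num at h
      exact_mod_cast this
  · intro g h
    rw [inv_conj, char_conj, char_conj]
  · intro g z hz
    obtain ⟨c, hc, h⟩ := sq_char_cen C hirr hz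
    have hc0 : c ≠ 0 := by rintro rfl; norm_num at hc
    rw [(h g).1, (h g).2.1]
    field_simp
  · rw [v7, v7']; ring

theorem fin_inv [Fintype G] (C : Cov π) (S : Sys π) (hdim : Module.finrank ℂ U = 6) (hirr : Irr ρ)
    (hz : ∀ z ∈ Subgroup.center G, ρ z = 1) :
    Module.finrank ℂ (invariants (sq ρ)) = 1 := by
  have := invCard G
  have h1 := card_inv_mul_sum_char_eq_finrank (sq ρ)
  obtain ⟨h3, h6⟩ := nonfaith_val C S hdim hirr hz
  obtain ⟨v1, v2, v33, v42, v5, v7, v7', v3, v6⟩ := sq_vals C S hdim hirr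
  rw [C.avg S] at h1
  · rw [v1, v2, v33, v42, v5, v7, v3, v6, h3, h6] at h1
    have : ((Module.finrank ℂ (invariants (sq ρ)) : ℕ) : ℂ) = (1 : ℕ) := by
      rw [← h1]; norm_num
    exact_mod_cast this
  · intro g h
    rw [char_conj]
  · intro g z hz'
    have : sq ρ z = 1 := by
      rw [sq_cen ρ z 1 (by rw [hz _ (inv_mem hz'), one_smul])]; simp
    unfold character
    rw [map_mul, this, mul_one]
  · rw [v7, v7']

end Main
end TA7

namespace TA7
open Representation
set_option linter.unusedSectionVars false
section Abs
variable {G : Type} [Group G] [Fintype G]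
variable {V : Type} [AddCommGroup V] [Module ℂ V] [FiniteDimensional ℂ V] {τ : Representation ℂ G V}

def Stab (τ : Representation ℂ G V) (W : Submodule ℂ V) : Prop := ∀ g : G, ∀ v ∈ W, τ g v ∈ W

def IrrS (τ : Representation ℂ G V) (W : Submodule ℂ V) : Prop :=
  Stab τ W ∧ W ≠ ⊥ ∧ ∀ W' : Submodule ℂ V, W' ≤ W → Stab τ W' → W' = ⊥ ∨ W' = W

theorem exists_proj {W : Submodule ℂ V} (hW : Stab τ W) :
    ∃ P : IntertwiningMap τ τ, (∀ v, P v ∈ W) ∧ ∀ v ∈ W, P v = v := by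
  obtain ⟨p, hp⟩ := W.subtype.exists_leftInverse_of_injective W.ker_subtype
  have hp' : ∀ v ∈ W, (p v : V) = v := fun v hv => by
    have := LinearMap.congr_fun hp ⟨v, hv⟩
    exact congrArg Subtype.val this
  have hc : (Fintype.card G : ℂ) ≠ 0 := by exact_mod_cast Fintype.card_ne_zero
  let A : V →ₗ[ℂ] V := (Fintype.card G : ℂ)⁻¹ • ∑ g : G, (τ g ∘ₗ W.subtype ∘ₗ p ∘ₗ τ g⁻¹)
  have hA : ∀ v, A v = (Fintype.card G : ℂ)⁻¹ • ∑ g : G, τ g (p (τ g⁻¹ v)) := fun v => by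
    simp [A, LinearMap.sum_apply]
  refine ⟨A.intertwiningMap_of_isIntertwiningMap _ _ ?_, ?_, ?_⟩
  · intro h v
    rw [hA, hA, map_smul, map_sum]
    congr 1
    refine Fintype.sum_equiv (Equiv.mulLeft h⁻¹) _ _ (fun g => ?_)
    simp only [Equiv.coe_mulLeft, mul_inv_rev, inv_inv, map_mul, Module.End.mul_apply]
    rw [← Module.End.mul_apply (τ h) (τ h⁻¹), ← map_mul, mul_inv_cancel, map_one, Module.End.one_apply]
  · intro v
    change A v ∈ W
    rw [hA]
    exact W.smul_mem _ (W.sum_mem (fun g _ => hW g _ (p _).2))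
  · intro v hv
    change A v = v
    rw [hA]
    have : ∀ g : G, τ g (p (τ g⁻¹ v)) = v := fun g => by
      rw [hp' _ (hW g⁻¹ v hv), ← Module.End.mul_apply, ← map_mul, mul_inv_cancel, map_one, Module.End.one_apply]
    simp only [this, Finset.sum_const, Finset.card_univ]
    rw [← Nat.cast_smul_eq_nsmul ℂ, smul_smul, inv_mul_cancel₀ hc, one_smul]

theorem chain_aux (m : ℕ) (W : Fin (m + 1) → Submodule ℂ V) (hm : StrictMono W) (hW : ∀ i, Stab τ (W i)) :
    ∃ P : Fin m → IntertwiningMap τ τ, LinearIndependent ℂ P ∧ ∀ i v, P i v ∈ W (Fin.last m) := by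
  induction m with
  | zero => exact ⟨Fin.elim0, linearIndependent_empty_type, fun i => i.elim0⟩
  | succ m ih =>
    obtain ⟨P, hP, hP'⟩ := ih (fun i => W i.castSucc) (fun i j h => hm (Fin.castSucc_lt_castSucc_iff.2 h)) (fun i => hW _)
    obtain ⟨Q, hQ, hQ'⟩ := exists_proj (hW (Fin.last (m + 1)))
    have hlt : W (Fin.last m).castSucc < W (Fin.last (m + 1)) := hm (Fin.castSucc_lt_last _)
    refine ⟨Fin.snoc (α := fun _ => IntertwiningMap τ τ) P Q, ?_, ?_⟩
    · rw [linearIndependent_finSnoc]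
      refine ⟨hP, fun hmem => ?_⟩
      obtain ⟨v, hv, hv'⟩ := SetLike.exists_of_lt hlt
      apply hv'
      have : ∀ R ∈ Submodule.span ℂ (Set.range P), R v ∈ W (Fin.last m).castSucc := by
        intro R hR
        induction hR using Submodule.span_induction with
        | mem x hx => obtain ⟨i, rfl⟩ := hx; exact hP' i v
        | zero => exact Submodule.zero_mem _
        | add x y _ _ hx hy => exact Submodule.add_mem _ hx hy
        | smul a x _ hx => exact Submodule.smul_mem _ a hx
      have h := this Q hmem
      rwa [hQ' v hv] at h
    · intro i v
      induction i using Fin.lastCases with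
      | last => rw [Fin.snoc_last]; exact hQ v
      | cast i => rw [Fin.snoc_castSucc]; exact hlt.le (hP' i v)

theorem chain {m n : ℕ} (hn : Module.finrank ℂ (IntertwiningMap τ τ) = n + 1)
    (W : Fin (m + 1) → Submodule ℂ V) (hm : StrictMono W) (hW : ∀ i, Stab τ (W i)) : m ≤ n + 1 := by
  obtain ⟨P, hP, -⟩ := chain_aux m W hm hW
  have : Module.Finite ℂ (IntertwiningMap τ τ) := Module.finite_of_finrank_pos (by omega)
  have := hP.fintype_card_le_finrank
  rwa [Fintype.card_fin, hn] at this

theorem compl {W : Submodule ℂ V} (hW : Stab τ W) :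
    ∃ W' : Submodule ℂ V, Stab τ W' ∧ W ⊓ W' = ⊥ ∧ W ⊔ W' = ⊤ ∧
      ∃ Q : V →ₗ[ℂ] V, (∀ g v, Q (τ g v) = τ g (Q v)) ∧ (∀ v, Q v ∈ W') ∧ (∀ v, Q v = 0 → v ∈ W) := by
  obtain ⟨P, h1, h2⟩ := exists_proj hW
  have hP : ∀ g v, P (τ g v) = τ g (P v) := fun g v => LinearMap.congr_fun (P.isIntertwining' g) v
  have hP0 : ∀ v, P (v - P v) = 0 := fun v => by
    rw [map_sub, h2 _ (h1 v), sub_self]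
  refine ⟨LinearMap.ker P.toLinearMap, ?_, ?_, ?_, LinearMap.id - P.toLinearMap, ?_, ?_, ?_⟩
  · intro g v hv
    have hv : P v = 0 := hv
    change P (τ g v) = 0
    rw [hP, hv, map_zero]
  · rw [Submodule.eq_bot_iff]
    rintro v ⟨hv, hv'⟩
    rw [← h2 v hv]; exact hv'
  · rw [eq_top_iff]
    intro v _
    rw [← add_sub_cancel (P v) v]
    exact Submodule.add_mem_sup (h1 v) (hP0 v)
  · intro g v
    change τ g v - P (τ g v) = τ g (v - P v)
    rw [hP, map_sub]
  · intro v
    exact hP0 v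
  · intro v hv
    have : v - P v = 0 := hv
    rw [sub_eq_zero.1 this]; exact h1 v

theorem le_of_big {W W' X : Submodule ℂ V} (hW' : ∀ Y ≤ W', Stab τ Y → Y = ⊥ ∨ Y = W')
    (Q : V →ₗ[ℂ] V) (hQ : ∀ g v, Q (τ g v) = τ g (Q v)) (h1 : ∀ v, Q v ∈ W') (h2 : ∀ v, Q v = 0 → v ∈ W)
    (hX : Stab τ X) (hlt : Module.finrank ℂ X < Module.finrank ℂ W') : X ≤ W := by
  rcases hW' (X.map Q) (by rintro _ ⟨v, -, rfl⟩; exact h1 v)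
    (by rintro g _ ⟨v, hv, rfl⟩; rw [← hQ]; exact ⟨_, hX g v hv, rfl⟩) with h | h
  · intro v hv
    apply h2
    rw [Submodule.eq_bot_iff] at h
    exact h _ ⟨v, hv, rfl⟩
  · have := Submodule.finrank_map_le Q X
    rw [h] at this
    omega

theorem stab_bot : Stab τ ⊥ := by
  intro g v hv
  rw [Submodule.mem_bot] at hv ⊢
  rw [hv, map_zero]

theorem stab_top : Stab τ ⊤ := fun _ _ _ => trivial

theorem Stab.sup {W W' : Submodule ℂ V} (h : Stab τ W) (h' : Stab τ W') : Stab τ (W ⊔ W') := by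
  intro g v hv
  obtain ⟨a, ha, b, hb, rfl⟩ := Submodule.mem_sup.1 hv
  rw [map_add]
  exact Submodule.add_mem_sup (h g a ha) (h' g b hb)

theorem Stab.inf {W W' : Submodule ℂ V} (h : Stab τ W) (h' : Stab τ W') : Stab τ (W ⊓ W') :=
  fun g v hv => ⟨h g v hv.1, h' g v hv.2⟩

theorem absA (hV : Module.finrank ℂ V = 21) (hE : Module.finrank ℂ (IntertwiningMap τ τ) = 2)
    {W₁ : Submodule ℂ V} (h1 : IrrS τ W₁) (hd : Module.finrank ℂ W₁ = 6) :
    ∃ W₂ : Submodule ℂ V, W₁ ⊓ W₂ = ⊥ ∧ W₁ ⊔ W₂ = ⊤ ∧ IrrS τ W₂ ∧ Module.finrank ℂ W₂ = 15 ∧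
    ∀ X : Submodule ℂ V, IrrS τ X → Module.finrank ℂ X = 6 → X = W₁ := by
  obtain ⟨W₂, hs, hi, hu, Q, hQ, hQ1, hQ2⟩ := compl h1.1
  have hf := Submodule.finrank_sup_add_finrank_inf_eq W₁ W₂
  rw [hi, hu, finrank_top, finrank_bot, hV, hd] at hf
  have hirr : ∀ Y ≤ W₂, Stab τ Y → Y = ⊥ ∨ Y = W₂ := by
    intro Y hY hYs
    by_contra! hcon
    have hlt : W₂ < ⊤ := by
      rw [lt_top_iff_ne_top]
      rintro rfl
      rw [finrank_top] at hf; omega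
    have := chain (m := 3) (n := 1) hE ![⊥, Y, W₂, ⊤] (by
      rw [Fin.strictMono_iff_lt_succ]
      intro i
      fin_cases i
      · exact bot_lt_iff_ne_bot.2 hcon.1
      · exact lt_of_le_of_ne hY hcon.2
      · exact hlt) (by
      intro i
      fin_cases i
      · exact stab_bot
      · exact hYs
      · exact hs
      · exact stab_top)
    omega
  refine ⟨W₂, hi, hu, ⟨hs, ?_, hirr⟩, by omega, ?_⟩
  · rintro rfl
    rw [finrank_bot] at hf; omega
  · intro X hX hX6
    exact Submodule.eq_of_le_of_finrank_eq (le_of_big hirr Q hQ hQ1 hQ2 hX.1 (by omega)) (by omega)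

theorem absB (hV : Module.finrank ℂ V = 21) (hE : Module.finrank ℂ (IntertwiningMap τ τ) = 3)
    {W₀ W₁ : Submodule ℂ V} (h0 : Stab τ W₀) (hd0 : Module.finrank ℂ W₀ = 1)
    (h1 : IrrS τ W₁) (hd : Module.finrank ℂ W₁ = 6) :
    ∃ W₂ : Submodule ℂ V, W₀ ⊓ W₁ = ⊥ ∧ (W₀ ⊔ W₁) ⊓ W₂ = ⊥ ∧ (W₀ ⊔ W₁) ⊔ W₂ = ⊤ ∧ IrrS τ W₂ ∧ Module.finrank ℂ W₂ = 14 ∧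
    ∀ X : Submodule ℂ V, IrrS τ X → Module.finrank ℂ X = 6 → X = W₁ := by
  obtain ⟨W₂, hs, hi, hu, Q, hQ, hQ1, hQ2⟩ := compl (h0.sup h1.1)
  have hf := Submodule.finrank_sup_add_finrank_inf_eq (W₀ ⊔ W₁) W₂
  have h01 : W₀ ⊓ W₁ = ⊥ := by
    rcases h1.2.2 _ inf_le_right (h0.inf h1.1) with h | h
    · exact h
    · have := Submodule.finrank_mono (inf_eq_right.1 h)
      omega
  have hf' := Submodule.finrank_sup_add_finrank_inf_eq W₀ W₁
  rw [h01, finrank_bot, hd0, hd] at hf'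
  rw [hi, hu, finrank_top, finrank_bot, hV] at hf
  have hirr : ∀ Y ≤ W₂, Stab τ Y → Y = ⊥ ∨ Y = W₂ := by
    intro Y hY hYs
    by_contra! hcon
    have hf2 := Submodule.finrank_sup_add_finrank_inf_eq W₂ W₁
    have hi2 : W₂ ⊓ W₁ = ⊥ := by
      rw [eq_bot_iff, ← hi, inf_comm]
      exact inf_le_inf_right _ le_sup_right
    rw [hi2, finrank_bot] at hf2
    have hlt : W₂ < W₂ ⊔ W₁ := by
      refine lt_of_le_of_ne le_sup_left (fun h => ?_)
      rw [← h] at hf2; omega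
    have hlt2 : W₂ ⊔ W₁ < ⊤ := by
      rw [lt_top_iff_ne_top]
      intro h
      rw [h, finrank_top] at hf2; omega
    have := chain (m := 4) (n := 2) hE ![⊥, Y, W₂, W₂ ⊔ W₁, ⊤] (by
      rw [Fin.strictMono_iff_lt_succ]
      intro i
      fin_cases i
      · exact bot_lt_iff_ne_bot.2 hcon.1
      · exact lt_of_le_of_ne hY hcon.2
      · exact hlt
      · exact hlt2) (by
      intro i
      fin_cases i
      · exact stab_bot
      · exact hYs
      · exact hs
      · exact hs.sup h1.1
      · exact stab_top)
    omega
  refine ⟨W₂, h01, hi, hu, ⟨hs, ?_, hirr⟩, by omega, ?_⟩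
  · rintro rfl
    rw [finrank_bot] at hf; omega
  · intro X hX hX6
    have hle := le_of_big hirr Q hQ hQ1 hQ2 hX.1 (by omega)
    rcases hX.2.2 _ inf_le_left (hX.1.inf h1.1) with h | h
    · have h3 := Submodule.finrank_sup_add_finrank_inf_eq X W₁
      have h4 := Submodule.finrank_mono (sup_le hle (le_sup_right : W₁ ≤ W₀ ⊔ W₁))
      rw [h, finrank_bot] at h3
      omega
    · exact Submodule.eq_of_le_of_finrank_eq (inf_eq_left.1 h) (by omega)

end Abs
end TA7

namespace TA7
open Representation
set_option linter.unusedSectionVars false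
section Fin
variable {G : Type} [Group G] {π : G →* A7}
variable {U : Type} [AddCommGroup U] [Module ℂ U] [FiniteDimensional ℂ U] {ρ : Representation ℂ G U}

theorem one_dim {V : Type} [AddCommGroup V] [Module ℂ V] (W : Submodule ℂ V) (h : Module.finrank ℂ W = 1)
    {x y : V} (hx : x ∈ W) (hx0 : x ≠ 0) (hy : y ∈ W) : ∃ c : ℂ, y = c • x := by
  obtain ⟨c, hc⟩ := (finrank_eq_one_iff_of_nonzero' (K := ℂ) (⟨x, hx⟩ : W) (fun e => hx0 (congrArg Subtype.val e))).1 h ⟨y, hy⟩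
  exact ⟨c, (congrArg Subtype.val hc).symm⟩

theorem exists_T [Fintype G] (C : Cov π) (S : Sys π) (hdim : Module.finrank ℂ U = 6) (hirr : Irr ρ) :
    ∃ (h : U →ₗ[ℂ] symFormSpace U 2) (T : X3 U), h ≠ 0 ∧ (∀ g v, h (ρ g v) = sq ρ g (h v)) ∧
      (∀ u v w, T u v w = T v u w) ∧ (∀ u v w, T u v w = T u w v) ∧ (∀ u w, (h w).1 u = T u u w) ∧
      (∀ g, tri ρ g T = T) ∧ T ≠ 0 ∧ (∀ T' : X3 U, (∀ g, tri ρ g T' = T') → ∃ c : ℂ, T' = c • T) := by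
  obtain ⟨-, -, -, -, -, -, hone, -⟩ := vals C S hdim hirr
  obtain ⟨h0, h0ne⟩ : ∃ h0 : IntertwiningMap ρ (sq ρ), h0 ≠ 0 := by
    have : Nontrivial (IntertwiningMap ρ (sq ρ)) := Module.nontrivial_of_finrank_pos (R := ℂ) (by
      rw [fin_U C S hdim hirr]; norm_num)
    exact exists_ne 0
  let h : U →ₗ[ℂ] symFormSpace U 2 := h0.toLinearMap
  have hh : ∀ g v, h (ρ g v) = sq ρ g (h v) := fun g v => LinearMap.congr_fun (h0.isIntertwining' g) v
  have hne : h ≠ 0 := fun e => h0ne (by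
    apply DFunLike.ext
    intro v
    exact LinearMap.congr_fun e v)
  obtain ⟨s, s1, s2⟩ := exists_sec (U := U)
  have s1' : ∀ f, qV U (s f) = f := fun f => LinearMap.congr_fun s1 f
  have s2' : ∀ B, s (qV U B) = sy U B := fun B => LinearMap.congr_fun s2 B
  have ssy : ∀ f, s f = sy U (s f) := fun f => by rw [← s2', s1']
  have sxa : ∀ A f, s (sA A f) = xa A (s f) := fun A f => by
    have e : sA A f = qV U (xa A (s f)) := by
      conv_lhs => rw [← s1' f]
      rfl
    rw [e, s2']
    conv_rhs => rw [ssy]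
    rfl
  let T : X3 U := s ∘ₗ h
  have hT : ∀ w u v, T w u v = s (h w) u v := fun _ _ _ => rfl
  have hd : ∀ u w, (h w).1 u = T w u u := fun u w => by
    rw [hT]
    conv_lhs => rw [← s1' (h w)]
    rfl
  have t23 : ∀ u v w, T u v w = T u w v := fun u v w => by
    rw [hT, hT, ssy, sy_apply, sy_apply]; ring
  have Tinv : ∀ g, tri ρ g T = T := fun g => by
    ext u v w
    rw [tri_apply, hT, hT, hh]
    change s (sA (ρ g⁻¹⁻¹) (h u)) _ _ = _
    rw [sxa, xa_apply, inv_inv]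
    simp
  have Tne : T ≠ 0 := by
    intro e
    apply hne
    ext w u
    rw [hd, e]; rfl
  have huniq : ∀ T' : X3 U, (∀ g, tri ρ g T' = T') → ∃ c : ℂ, T' = c • T := by
    intro T' hT'
    exact one_dim (V := X3 U) (invariants (V := X3 U) (tri ρ)) hone (x := T) (y := T') Tinv Tne hT'
  obtain ⟨c, hc⟩ := huniq T.flip (fun g => by
    ext u v w
    rw [tri_apply, LinearMap.flip_apply, LinearMap.flip_apply]
    conv_rhs => rw [← Tinv g]
    rfl)
  have t12 : ∀ u v w, T v u w = c * T u v w := fun u v w => by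
    have := LinearMap.congr_fun (LinearMap.congr_fun (LinearMap.congr_fun hc u) v) w
    exact this
  have hc1 : c = 1 := by
    obtain ⟨u, v, w, hn⟩ : ∃ u v w, T u v w ≠ 0 := by
      by_contra! hcon
      exact Tne (by ext u v w; exact hcon u v w)
    have e2 : T u v w = c * (c * T u v w) := by rw [← t12 u v w, ← t12 v u w]
    have e3 : T u v w = c * (c * (c * T u v w)) := by
      rw [← t12 u v w, t23 v u w, ← t12 v w u, t23 w v u, ← t12 w u v, t23]
    have h2 : c * c = 1 := by
      apply mul_right_cancel₀ hn; linear_combination -e2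
    have h3 : c * c * c = 1 := by
      apply mul_right_cancel₀ hn; linear_combination -e3
    linear_combination h3 - c * h2
  rw [hc1] at t12
  have t12' : ∀ u v w, T u v w = T v u w := fun u v w => by rw [t12 u v w, one_mul]
  exact ⟨h, T, hne, hh, t12', t23, fun u w => by rw [hd, t12' w u u, t23 u w u], Tinv, Tne, huniq⟩

theorem cube_ne {T : X3 U} (t12 : ∀ u v w, T u v w = T v u w) (t23 : ∀ u v w, T u v w = T u w v)
    {h : U →ₗ[ℂ] symFormSpace U 2} (hne : h ≠ 0) (hd : ∀ u w, (h w).1 u = T u u w) :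
    (fun u : U => T u u u) ≠ 0 := by
  intro e
  have e' : ∀ u, T u u u = 0 := fun u => congrFun e u
  apply hne
  ext w u
  rw [hd]
  change T u u w = 0
  have a := e' (u + w)
  have b := e' (u - w)
  simp only [map_add, map_sub, LinearMap.add_apply, LinearMap.sub_apply, e'] at a b
  have x1 : T u w u = T u u w := t23 _ _ _
  have x2 : T w u u = T u u w := by rw [t12, t23]
  have x3 : T w u w = T u w w := t12 _ _ _
  have x4 : T w w u = T u w w := by rw [t23, t12]
  rw [x1, x2, x3, x4] at a b
  linear_combination (1/6) * a - (1/6) * b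

theorem cube_uniq [Fintype G] {T : X3 U} (huniq : ∀ T' : X3 U, (∀ g, tri ρ g T' = T') → ∃ c : ℂ, T' = c • T) :
    ∀ c ∈ symFormSpace U 3, (∀ g : G, formAct ρ g c = c) → ∃ t : ℂ, c = t • fun u => T u u u := by
  intro c hc hinv
  rw [← q3_range] at hc
  obtain ⟨T', rfl⟩ := hc
  have hcard : (Fintype.card G : ℂ) ≠ 0 := by exact_mod_cast Fintype.card_ne_zero
  obtain ⟨a, ha⟩ := huniq (∑ g : G, tri ρ g T') (fun k => by
    rw [map_sum]
    refine Fintype.sum_equiv (Equiv.mulLeft k) _ _ (fun g => ?_)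
    simp only [Equiv.coe_mulLeft, map_mul, Module.End.mul_apply])
  have h1 : ∀ g : G, q3 U (tri ρ g T') = q3 U T' := fun g => hinv g⁻¹
  have h2 := congrArg (q3 U) ha
  rw [map_sum, map_smul] at h2
  simp only [h1, Finset.sum_const, Finset.card_univ] at h2
  rw [← Nat.cast_smul_eq_nsmul ℂ] at h2
  refine ⟨(Fintype.card G : ℂ)⁻¹ * a, ?_⟩
  rw [mul_smul]
  change _ = _ • a • q3 U T
  rw [← h2, smul_smul, inv_mul_cancel₀ hcard, one_smul]

/-- transport -/
noncomputable abbrev up (W : Submodule ℂ (symFormSpace U 2)) : Submodule ℂ (U → ℂ) := W.map (symFormSpace U 2).subtype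

theorem up_comap {X : Submodule ℂ (U → ℂ)} (h : X ≤ symFormSpace U 2) :
    up (X.comap (symFormSpace U 2).subtype) = X := by
  rw [up, Submodule.map_comap_subtype, inf_eq_right.2 h]

theorem up_stab {W : Submodule ℂ (symFormSpace U 2)} : IsSubrep ρ (up W) ↔ Stab (sq ρ) W := by
  constructor
  · intro h g v hv
    obtain ⟨w, hw, e⟩ := h g⁻¹ v.1 ⟨v, hv, rfl⟩
    have : w = sq ρ g v := Subtype.ext e
    rwa [← this]
  · rintro h g _ ⟨v, hv, rfl⟩
    refine ⟨sq ρ g⁻¹ v, h _ _ hv, ?_⟩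
    change formAct ρ g⁻¹⁻¹ v.1 = _
    rw [inv_inv]; rfl

theorem up_inj : Function.Injective (up (U := U)) :=
  Submodule.map_injective_of_injective (symFormSpace U 2).injective_subtype

theorem up_le (W : Submodule ℂ (symFormSpace U 2)) : up W ≤ symFormSpace U 2 := by
  rintro _ ⟨v, -, rfl⟩; exact v.2

theorem up_bot : up (⊥ : Submodule ℂ (symFormSpace U 2)) = ⊥ := Submodule.map_bot _

theorem up_top : up (⊤ : Submodule ℂ (symFormSpace U 2)) = symFormSpace U 2 := by simp [up]

theorem up_finrank (W : Submodule ℂ (symFormSpace U 2)) : Module.finrank ℂ (up W) = Module.finrank ℂ W :=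
  Submodule.finrank_map_subtype_eq _ _

theorem up_irr {W : Submodule ℂ (symFormSpace U 2)} : IsIrredSubrep ρ (up W) ↔ IrrS (sq ρ) W := by
  refine and_congr up_stab (and_congr ?_ ?_)
  · rw [← up_bot, up_inj.ne_iff]
  · constructor
    · intro h W' hW' hs
      rcases h (up W') (Submodule.map_mono hW') (up_stab.2 hs) with h | h
      · left; apply up_inj; rw [h, up_bot]
      · right; exact up_inj h
    · intro h X hX hs
      have hX' := hX.trans (up_le W)
      obtain ⟨Y, rfl⟩ : ∃ Y, up Y = X := ⟨_, up_comap hX'⟩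
      rcases h Y (fun v hv => by
        obtain ⟨w, hw, e⟩ := hX ⟨v, hv, rfl⟩
        rwa [← Subtype.ext e]) (up_stab.1 hs) with h | h
      · left; rw [h, up_bot]
      · right; rw [h]

end Fin
end TA7

namespace TA7
open Representation
set_option linter.unusedSectionVars false
section Fin
variable {G : Type} [Group G] {π : G →* A7}
variable {U : Type} [AddCommGroup U] [Module ℂ U] [FiniteDimensional ℂ U] {ρ : Representation ℂ G U}

theorem indep3 {V : Type} [AddCommGroup V] [Module ℂ V] {A B D : Submodule ℂ V} (h1 : A ⊓ B = ⊥)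
    (h2 : (A ⊔ B) ⊓ D = ⊥) : iSupIndep ![A, B, D] := by
  have d1 : Disjoint A B := disjoint_iff.2 h1
  have d2 : Disjoint (A ⊔ B) D := disjoint_iff.2 h2
  have e1 : Disjoint A (B ⊔ D) := d1.disjoint_sup_right_of_disjoint_sup_left d2
  have e2 : Disjoint B (A ⊔ D) := d1.symm.disjoint_sup_right_of_disjoint_sup_left (by rwa [sup_comm])
  intro i
  fin_cases i
  · refine e1.mono_right (iSup₂_le fun j hj => ?_)
    fin_cases j
    · exact absurd rfl hj
    · exact le_sup_left
    · exact le_sup_right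
  · refine e2.mono_right (iSup₂_le fun j hj => ?_)
    fin_cases j
    · exact le_sup_left
    · exact absurd rfl hj
    · exact le_sup_right
  · refine d2.symm.mono_right (iSup₂_le fun j hj => ?_)
    fin_cases j
    · exact le_sup_left
    · exact le_sup_right
    · exact absurd rfl hj

theorem irr_inj (hirr : Irr ρ) {h : U →ₗ[ℂ] symFormSpace U 2} (hne : h ≠ 0)
    (hh : ∀ g v, h (ρ g v) = sq ρ g (h v)) : Function.Injective h := by
  rw [← LinearMap.ker_eq_bot]
  rcases hirr (LinearMap.ker h) (fun g v hv => by
    rw [LinearMap.mem_ker] at hv ⊢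
    rw [hh, hv, map_zero]) with e | e
  · exact e
  · exact absurd (LinearMap.ker_eq_top.1 e) hne

theorem irr_range (hirr : Irr ρ) {h : U →ₗ[ℂ] symFormSpace U 2} (hne : h ≠ 0)
    (hh : ∀ g v, h (ρ g v) = sq ρ g (h v)) : IrrS (sq ρ) (LinearMap.range h) := by
  refine ⟨?_, fun e => hne (LinearMap.range_eq_bot.1 e), ?_⟩
  · rintro g _ ⟨v, rfl⟩
    exact ⟨ρ g v, hh g v⟩
  · intro W' hW' hs
    rcases hirr (W'.comap h) (fun g v hv => by
      rw [Submodule.mem_comap] at hv ⊢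
      rw [hh]; exact hs g _ hv) with e | e
    · left
      rw [Submodule.eq_bot_iff]
      intro x hx
      obtain ⟨v, rfl⟩ := hW' hx
      have : v ∈ W'.comap h := hx
      rw [e, Submodule.mem_bot] at this
      rw [this, map_zero]
    · right
      apply le_antisymm hW'
      rintro _ ⟨v, rfl⟩
      have : v ∈ W'.comap h := by rw [e]; trivial
      exact this

theorem copy_range (hirr : Irr ρ) {h : U →ₗ[ℂ] symFormSpace U 2} (hne : h ≠ 0)
    (hh : ∀ g v, h (ρ g v) = sq ρ g (h v)) : IsCopyOfU ρ (up (LinearMap.range h)) := by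
  refine ⟨(symFormSpace U 2).subtype ∘ₗ h, ?_, ?_, ?_⟩
  · exact Subtype.val_injective.comp (irr_inj hirr hne hh)
  · rw [LinearMap.range_comp]
  · intro g u
    change (h (ρ g u)).1 = _
    rw [hh]; rfl

theorem faithful_on (C : Cov π) (hdim : Module.finrank ℂ U = 6) (hirr : Irr ρ) (hinj : Function.Injective ρ)
    {W : Submodule ℂ (symFormSpace U 2)} (hW : IrrS (sq ρ) W) (hd : 1 < Module.finrank ℂ W) :
    FaithfulOn ρ (up W) := by
  have := nontriv hdim
  intro g hg
  have hg' : ∀ f ∈ W, sq ρ g⁻¹ f = f := fun f hf => by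
    apply Subtype.ext
    rw [sq_apply, inv_inv]
    exact hg _ ⟨f, hf, rfl⟩
  let σ := (sq ρ).subrepresentation W (fun g v hv => hW.1 g v hv)
  have hσ : Irr (G := G) (U := W) σ := by
    intro Y hY
    rcases hW.2.2 (Y.map W.subtype) (by rintro _ ⟨v, -, rfl⟩; exact v.2) (by
      rintro g _ ⟨v, hv, rfl⟩
      exact ⟨σ g v, hY g v hv, rfl⟩) with e | e
    · left
      apply Submodule.map_injective_of_injective W.injective_subtype
      rw [e, Submodule.map_bot]
    · right
      apply Submodule.map_injective_of_injective W.injective_subtype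
      rw [e]; simp
  have h1 : π g⁻¹ = 1 := C.ker_le (U := W) (ρ := σ) hd hσ (by
    ext1 v
    exact Subtype.ext (hg' v.1 v.2))
  have hc : g⁻¹ ∈ Subgroup.center G := (C.ker _).1 h1
  have hc' : g ∈ Subgroup.center G := by simpa using inv_mem hc
  obtain ⟨c, h3, e⟩ := C.scalar hirr hc'
  have hs := sq_cen ρ g⁻¹ c (by rw [inv_inv]; exact e)
  obtain ⟨f, hf, hf0⟩ := Submodule.exists_mem_ne_zero_of_ne_bot hW.2.1
  have h4 := hg' f hf
  rw [hs] at h4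
  have h6 : c ^ 2 - 1 = 0 := by
    obtain ⟨u, hu⟩ : ∃ u, f.1 u ≠ 0 := by
      by_contra! hcon
      exact hf0 (Subtype.ext (funext hcon))
    have h5 : c ^ 2 * f.1 u = f.1 u := congrFun (congrArg Subtype.val h4) u
    apply (mul_eq_zero.1 (?_ : (c ^ 2 - 1) * f.1 u = 0)).resolve_right hu
    linear_combination h5
  have h7 : c = 1 := by linear_combination h3 - c * h6
  apply hinj
  rw [e, h7, one_smul, map_one]

theorem final [Fintype G] (C : Cov π) (S : Sys π) (h3 : Nat.card (Subgroup.center G) = 3)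
    (hdim : Module.finrank ℂ U = 6) (hirr : Irr ρ) :
    (Function.Injective ρ →
      ∃ W₁ W₂ : Submodule ℂ (U → ℂ),
        W₁ ⊓ W₂ = ⊥ ∧ W₁ ⊔ W₂ = symFormSpace U 2 ∧
        IsIrredSubrep ρ W₁ ∧ Module.finrank ℂ W₁ = 6 ∧ IsCopyOfU ρ W₁ ∧
        IsIrredSubrep ρ W₂ ∧ Module.finrank ℂ W₂ = 15 ∧ FaithfulOn ρ W₂) ∧
    (¬ Function.Injective ρ →
      ∃ W₀ W₁ W₂ : Submodule ℂ (U → ℂ),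
        iSupIndep ![W₀, W₁, W₂] ∧ W₀ ⊔ W₁ ⊔ W₂ = symFormSpace U 2 ∧
        IsSubrep ρ W₀ ∧ Module.finrank ℂ W₀ = 1 ∧
          (∀ g : G, ∀ f ∈ W₀, formAct ρ g f = f) ∧
        IsIrredSubrep ρ W₁ ∧ Module.finrank ℂ W₁ = 6 ∧ IsCopyOfU ρ W₁ ∧
        IsIrredSubrep ρ W₂ ∧ Module.finrank ℂ W₂ = 14 ∧
          (∃ g : G, g ≠ 1 ∧ ∀ f ∈ W₂, formAct ρ g f = f)) ∧
    ∃ T : U →ₗ[ℂ] U →ₗ[ℂ] U →ₗ[ℂ] ℂ,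
      (∀ u v w : U, T u v w = T v u w) ∧ (∀ u v w : U, T u v w = T u w v) ∧
      (fun u => T u u u) ∈ symFormSpace U 3 ∧ (fun u : U => T u u u) ≠ 0 ∧
      (∀ g : G, formAct ρ g (fun u => T u u u) = fun u => T u u u) ∧
      (∀ c ∈ symFormSpace U 3, (∀ g : G, formAct ρ g c = c) →
        ∃ t : ℂ, c = t • fun u => T u u u) ∧
      ∀ W : Submodule ℂ (U → ℂ), W ≤ symFormSpace U 2 → IsIrredSubrep ρ W →
        Module.finrank ℂ W = 6 →
        W = Submodule.span ℂ {f | ∃ w : U, f = fun u => T u u w} := by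
  obtain ⟨h, T, hne, hh, t12, t23, hd, Tinv, Tne, huniq⟩ := exists_T C S hdim hirr
  have hI := irr_range hirr hne hh
  have hr6 : Module.finrank ℂ (LinearMap.range h) = 6 := by
    rw [LinearMap.finrank_range_of_inj (irr_inj hirr hne hh), hdim]
  have hz : ∃ z ∈ Subgroup.center G, z ≠ 1 := by
    have : Nontrivial (Subgroup.center G) := (Finite.one_lt_card_iff_nontrivial).1 (by rw [h3]; norm_num)
    obtain ⟨z, hz⟩ := exists_ne (1 : Subgroup.center G)
    exact ⟨z.1, z.2, fun e => hz (Subtype.ext e)⟩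
  have main : ((Function.Injective ρ →
      ∃ W₁ W₂ : Submodule ℂ (U → ℂ),
        W₁ ⊓ W₂ = ⊥ ∧ W₁ ⊔ W₂ = symFormSpace U 2 ∧
        IsIrredSubrep ρ W₁ ∧ Module.finrank ℂ W₁ = 6 ∧ IsCopyOfU ρ W₁ ∧
        IsIrredSubrep ρ W₂ ∧ Module.finrank ℂ W₂ = 15 ∧ FaithfulOn ρ W₂) ∧
    (¬ Function.Injective ρ →
      ∃ W₀ W₁ W₂ : Submodule ℂ (U → ℂ),
        iSupIndep ![W₀, W₁, W₂] ∧ W₀ ⊔ W₁ ⊔ W₂ = symFormSpace U 2 ∧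
        IsSubrep ρ W₀ ∧ Module.finrank ℂ W₀ = 1 ∧
          (∀ g : G, ∀ f ∈ W₀, formAct ρ g f = f) ∧
        IsIrredSubrep ρ W₁ ∧ Module.finrank ℂ W₁ = 6 ∧ IsCopyOfU ρ W₁ ∧
        IsIrredSubrep ρ W₂ ∧ Module.finrank ℂ W₂ = 14 ∧
          (∃ g : G, g ≠ 1 ∧ ∀ f ∈ W₂, formAct ρ g f = f))) ∧
      ∀ X : Submodule ℂ (symFormSpace U 2), IrrS (sq ρ) X → Module.finrank ℂ X = 6 → X = LinearMap.range h := by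
    by_cases hinj : Function.Injective ρ
    · obtain ⟨W₂, a1, a2, a3, a4, a5⟩ := absA (sq_dim hdim)
        ((fin_V C S hdim hirr).1 (faith_val C S hdim hirr hz hinj)) hI hr6
      refine ⟨⟨fun _ => ⟨up (LinearMap.range h), up W₂, ?_, ?_, up_irr.2 hI, ?_, copy_range hirr hne hh,
        up_irr.2 a3, ?_, faithful_on C hdim hirr hinj a3 (by omega)⟩, fun hn => absurd hinj hn⟩, a5⟩
      · rw [up, up, ← Submodule.map_inf _ (symFormSpace U 2).injective_subtype, a1]; exact up_bot
      · rw [up, up, ← Submodule.map_sup, a2]; exact up_top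
      · rw [up_finrank, hr6]
      · rw [up_finrank, a4]
    · obtain ⟨⟨k, hk, hk1, hkρ⟩, hcen⟩ := nonfaith_cen C hdim hirr h3 hinj
      have hinv : Stab (sq ρ) (invariants (sq ρ)) := fun g v hv => by
        rw [hv g]; exact hv
      obtain ⟨W₂, a0, a1, a2, a3, a4, a5⟩ := absB (sq_dim hdim)
        ((fin_V C S hdim hirr).2 (nonfaith_val C S hdim hirr hcen).1) hinv (fin_inv C S hdim hirr hcen) hI hr6
      refine ⟨⟨fun hn => absurd hn hinj, fun _ => ⟨up (invariants (sq ρ)), up (LinearMap.range h), up W₂,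
        indep3 ?_ ?_, ?_, up_stab.2 hinv, ?_, ?_, up_irr.2 hI, ?_, copy_range hirr hne hh,
        up_irr.2 a3, ?_, k, hk1, ?_⟩⟩, a5⟩
      · rw [up, up, ← Submodule.map_inf _ (symFormSpace U 2).injective_subtype, a0]; exact up_bot
      · rw [up, up, up, ← Submodule.map_sup, ← Submodule.map_inf _ (symFormSpace U 2).injective_subtype, a1]; exact up_bot
      · rw [up, up, up, ← Submodule.map_sup, ← Submodule.map_sup, a2]; exact up_top
      · rw [up_finrank, fin_inv C S hdim hirr hcen]
      · rintro g _ ⟨f, hf, rfl⟩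
        have := congrArg Subtype.val (hf g⁻¹)
        rw [sq_apply, inv_inv] at this
        exact this
      · rw [up_finrank, hr6]
      · rw [up_finrank, a4]
      · rintro _ ⟨f, hf, rfl⟩
        funext u
        change f.1 (ρ k u) = f.1 u
        rw [hkρ]; rfl
  refine ⟨main.1.1, main.1.2, T, t12, t23, q3_mem T, cube_ne t12 t23 hne hd, ?_, cube_uniq huniq, ?_⟩
  · intro g
    funext u
    change T (ρ g u) (ρ g u) (ρ g u) = T u u u
    have h1 := tri_apply (ρ := ρ) g⁻¹ T u u u
    rw [Tinv, inv_inv] at h1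
    exact h1.symm
  · intro W hW hWi hW6
    obtain ⟨X, rfl⟩ : ∃ X, up X = W := ⟨_, up_comap hW⟩
    rw [up_finrank] at hW6
    rw [main.2 X (up_irr.1 hWi) hW6]
    have : {f : U → ℂ | ∃ w : U, f = fun u => T u u w} = (up (LinearMap.range h) : Submodule ℂ (U → ℂ)) := by
      ext f
      constructor
      · rintro ⟨w, rfl⟩
        exact ⟨h w, ⟨w, rfl⟩, funext fun u => hd u w⟩
      · rintro ⟨_, ⟨w, rfl⟩, rfl⟩
        exact ⟨w, funext fun u => hd u w⟩
    rw [this, Submodule.span_eq]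

end Fin
end TA7

/-- Let `U` be an irreducible six-dimensional complex representation of `3.A₇`.
If `U` is faithful, then `S²U∨ ≅ U ⊕ U₁₅` with `U₁₅` a faithful irreducible representation of
dimension `15`; if `U` is not faithful, then `S²U∨` is the direct sum of the trivial
representation, a copy of `U`, and an irreducible non-faithful representation of dimension
`14`.  In either case `S²U∨` contains a unique six-dimensional irreducible subrepresentation,
namely the span of the partial derivatives `u ↦ T(u,u,w)` (for `w ∈ U`) of the unique (up to
scalar) invariant cubic form `u ↦ T(u,u,u)` on `U`. -/
theorem symSquareDual_of_six_dim_irreducible_3A7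
    (G : Type) [Group G] [Finite G] (hG : IsTripleCoverA7 G)
    (U : Type) [AddCommGroup U] [Module ℂ U] [FiniteDimensional ℂ U]
    (ρ : Representation ℂ G U)
    (hdim : Module.finrank ℂ U = 6)
    (hirr : ∀ W : Submodule ℂ U, (∀ g : G, ∀ v ∈ W, ρ g v ∈ W) → W = ⊥ ∨ W = ⊤) :
    (Function.Injective ρ →
      ∃ W₁ W₂ : Submodule ℂ (U → ℂ),
        W₁ ⊓ W₂ = ⊥ ∧ W₁ ⊔ W₂ = symFormSpace U 2 ∧
        IsIrredSubrep ρ W₁ ∧ Module.finrank ℂ W₁ = 6 ∧ IsCopyOfU ρ W₁ ∧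
        IsIrredSubrep ρ W₂ ∧ Module.finrank ℂ W₂ = 15 ∧ FaithfulOn ρ W₂) ∧
    (¬ Function.Injective ρ →
      ∃ W₀ W₁ W₂ : Submodule ℂ (U → ℂ),
        iSupIndep ![W₀, W₁, W₂] ∧ W₀ ⊔ W₁ ⊔ W₂ = symFormSpace U 2 ∧
        IsSubrep ρ W₀ ∧ Module.finrank ℂ W₀ = 1 ∧
          (∀ g : G, ∀ f ∈ W₀, formAct ρ g f = f) ∧
        IsIrredSubrep ρ W₁ ∧ Module.finrank ℂ W₁ = 6 ∧ IsCopyOfU ρ W₁ ∧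
        IsIrredSubrep ρ W₂ ∧ Module.finrank ℂ W₂ = 14 ∧
          (∃ g : G, g ≠ 1 ∧ ∀ f ∈ W₂, formAct ρ g f = f)) ∧
    ∃ T : U →ₗ[ℂ] U →ₗ[ℂ] U →ₗ[ℂ] ℂ,
      (∀ u v w : U, T u v w = T v u w) ∧ (∀ u v w : U, T u v w = T u w v) ∧
      (fun u => T u u u) ∈ symFormSpace U 3 ∧ (fun u : U => T u u u) ≠ 0 ∧
      (∀ g : G, formAct ρ g (fun u => T u u u) = fun u => T u u u) ∧
      (∀ c ∈ symFormSpace U 3, (∀ g : G, formAct ρ g c = c) →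
        ∃ t : ℂ, c = t • fun u => T u u u) ∧
      ∀ W : Submodule ℂ (U → ℂ), W ≤ symFormSpace U 2 → IsIrredSubrep ρ W →
        Module.finrank ℂ W = 6 →
        W = Submodule.span ℂ {f | ∃ w : U, f = fun u => T u u w} := by
  obtain ⟨π, C⟩ := TA7.exists_cov G hG
  obtain ⟨S⟩ := C.sys
  have := Fintype.ofFinite G
  exact TA7.final C S hG.2.2.1 hdim hirr
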